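/- arXiv:2010.06728 — 2 statements merged into one kernel-verified Lean document; each statement's English description precedes it below -/
import Mathlib

section
/- Let a > 0, L ≥ 1 and let g ∈ C²(ℝ) satisfy min_{x∈[−2a,2a]} g(x) = 4La, and set G := {(x,y) : x ∈ (−a,a), g(x) − La < y ≤ g(x)}. Suppose f ∈ C(G) is such that for each fixed x ∈ [−a,a] the function y ↦ f(x,y) is an algebraic polynomial of degree at most n. Then for every 0 < p ≤ ∞, every λ ∈ (1,2) and all nonnegative integers i, j there is a constant c > 0, independent of f and n, such that ‖ φ_n^i ∂₂^{i+j} f ‖_{L^p(G)} ≤ c n^{i+2j} ‖f‖_{L^p(G(λ))}. -/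
open MeasureTheory Set
open scoped ENNReal

noncomputable section

/-- Partial derivative `∂₁ = ∂/∂x` of a function on `ℝ²`. -/
def pd1 (f : ℝ × ℝ → ℝ) : ℝ × ℝ → ℝ := fun p => deriv (fun t => f (t, p.2)) p.1

/-- Partial derivative `∂₂ = ∂/∂y` of a function on `ℝ²`. -/
def pd2 (f : ℝ × ℝ → ℝ) : ℝ × ℝ → ℝ := fun p => deriv (fun t => f (p.1, t)) p.2

/-- The tangential derivative frozen at `x₀`:
`D_{x₀}^ℓ f = Σ_{i=0}^ℓ binom(ℓ,i) (g′(x₀))^i ∂₁^{ℓ−i} ∂₂^i f`. -/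
def DtanAt (g : ℝ → ℝ) (x₀ : ℝ) (ℓ : ℕ) (f : ℝ × ℝ → ℝ) : ℝ × ℝ → ℝ :=
  fun p => ∑ i ∈ Finset.range (ℓ + 1),
    (ℓ.choose i : ℝ) * deriv g x₀ ^ i * (pd1^[ℓ - i] (pd2^[i] f)) p

/-- The `ℓ`-th order tangential differential operator `D^{(ℓ)} f(x,y) = (D_x^ℓ f)(x,y)`. -/
def Dtan (g : ℝ → ℝ) (ℓ : ℕ) (f : ℝ × ℝ → ℝ) : ℝ × ℝ → ℝ :=
  fun p => DtanAt g p.1 ℓ f p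

/-- `f` is (the evaluation of) a real polynomial in two variables of total degree at most `n`. -/
def IsPoly2 (n : ℕ) (f : ℝ × ℝ → ℝ) : Prop :=
  ∃ P : MvPolynomial (Fin 2) ℝ, P.totalDegree ≤ n ∧
    ∀ p : ℝ × ℝ, f p = MvPolynomial.eval ![p.1, p.2] P

/-- The set `G(λ) = {(x,y) : x ∈ (−λa,λa), g(x) − λLa < y ≤ g(x)}`; `G = G(1)`. -/
def Gset (a L : ℝ) (g : ℝ → ℝ) (lam : ℝ) : Set (ℝ × ℝ) :=
  {p | p.1 ∈ Set.Ioo (-(lam * a)) (lam * a) ∧ g p.1 - lam * L * a < p.2 ∧ p.2 ≤ g p.1}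

/-- `φ_n(x,y) = √(g(x) − y) + 1/n`. -/
def phi2 (g : ℝ → ℝ) (n : ℕ) (p : ℝ × ℝ) : ℝ := Real.sqrt (g p.1 - p.2) + 1 / n

/-- For `p > 0` the function `‖P‖ ^ p` is dominated on the closed unit disc by the modulus of a
holomorphic function with which it agrees on the unit circle. -/
lemma exists_diffContOnCl_dominating (P : Polynomial ℂ) {p : ℝ} (hp : 0 < p) :
    ∃ h : ℂ → ℂ, DiffContOnCl ℂ h (Metric.ball 0 1) ∧
      (∀ w ∈ Metric.closedBall (0 : ℂ) 1, ‖P.eval w‖ ^ p ≤ ‖h w‖) ∧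
      ∀ w ∈ Metric.sphere (0 : ℂ) 1, ‖h w‖ = ‖P.eval w‖ ^ p := by
  have key : ∀ c : ℂ, ‖c‖ ≤ 1 →
      DiffContOnCl ℂ (fun w : ℂ => (1 - w * c) ^ (p : ℂ)) (Metric.ball 0 1) ∧
      ∀ w : ℂ, ‖(1 - w * c) ^ (p : ℂ)‖ = ‖1 - w * c‖ ^ p := by
    intro c hc
    refine ⟨⟨?_, ?_⟩, fun w => Complex.norm_cpow_real _ _⟩
    · intro w hw
      have hw' : ‖w * c‖ < 1 := by
        rw [norm_mul]
        have : ‖w‖ < 1 := by simpa using hw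
        nlinarith [norm_nonneg w, norm_nonneg c]
      have hre : 0 < (1 - w * c).re := by
        have := Complex.re_le_norm (w * c)
        simp only [Complex.sub_re, Complex.one_re]
        linarith
      have hd : DifferentiableAt ℂ (fun w : ℂ => 1 - w * c) w := by fun_prop
      exact (hd.cpow_const (Or.inl hre)).differentiableWithinAt
    · rw [closure_ball _ one_ne_zero]
      intro w hw
      have hw' : ‖w * c‖ ≤ 1 := by
        rw [norm_mul]
        have : ‖w‖ ≤ 1 := by simpa using hw
        nlinarith [norm_nonneg w, norm_nonneg c]
      have hcont : ContinuousAt (fun w : ℂ => 1 - w * c) w := by fun_prop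
      by_cases h0 : 1 - w * c = 0
      · have h1 : ContinuousAt (fun x : ℂ × ℂ => x.1 ^ x.2) (1 - w * c, (p : ℂ)) := by
          rw [h0]
          exact Complex.continuousAt_cpow_zero_of_re_pos (by simpa using hp)
        exact (h1.comp_of_eq (f := fun w : ℂ => (1 - w * c, (p : ℂ)))
          (hcont.prodMk continuousAt_const) rfl).continuousWithinAt
      · have hre : 0 < (1 - w * c).re := by
          by_contra hneg
          apply h0
          simp only [Complex.sub_re, Complex.one_re, not_lt, sub_nonpos] at hneg
          have hsq : (w * c).re ^ 2 + (w * c).im ^ 2 ≤ 1 := by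
            have := Complex.sq_norm (w * c)
            rw [Complex.normSq_apply] at this
            nlinarith [norm_nonneg (w * c)]
          have him : (w * c).im = 0 := by nlinarith
          have hre1 : (w * c).re = 1 := by nlinarith
          apply Complex.ext
          · rw [Complex.sub_re, hre1]; simp
          · rw [Complex.sub_im, him]; simp
        exact ((hcont : ContinuousAt _ _).cpow continuousAt_const (Or.inl hre)).continuousWithinAt
  have linear : ∀ a : ℂ, ∃ h : ℂ → ℂ, DiffContOnCl ℂ h (Metric.ball 0 1) ∧
      (∀ w ∈ Metric.closedBall (0 : ℂ) 1, ‖w - a‖ ^ p ≤ ‖h w‖) ∧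
      ∀ w ∈ Metric.sphere (0 : ℂ) 1, ‖h w‖ = ‖w - a‖ ^ p := by
    intro a
    rcases le_or_gt ‖a‖ 1 with ha | ha
    · obtain ⟨hd, hn⟩ := key (starRingEnd ℂ a) (by simpa using ha)
      have hsq : ∀ w : ℂ, ‖1 - w * starRingEnd ℂ a‖ ^ 2 - ‖w - a‖ ^ 2
          = (1 - ‖w‖ ^ 2) * (1 - ‖a‖ ^ 2) := by
        intro w
        simp only [Complex.sq_norm, Complex.normSq_apply, Complex.sub_re, Complex.sub_im,
          Complex.mul_re, Complex.mul_im, Complex.one_re, Complex.one_im, Complex.conj_re,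
          Complex.conj_im]
        ring
      refine ⟨_, hd, fun w hw => ?_, fun w hw => ?_⟩
      · rw [hn]
        have hw' : ‖w‖ ≤ 1 := by simpa using hw
        refine Real.rpow_le_rpow (norm_nonneg _) ?_ hp.le
        apply (sq_le_sq₀ (norm_nonneg _) (norm_nonneg _)).1
        have h1 : 0 ≤ (1 - ‖w‖ ^ 2) * (1 - ‖a‖ ^ 2) := by
          apply mul_nonneg <;> nlinarith [norm_nonneg w, norm_nonneg a]
        linarith [hsq w]
      · rw [hn]
        have hw' : ‖w‖ = 1 := by simpa using hw
        congr 1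
        have h1 := hsq w
        rw [hw'] at h1
        have h2 : ‖1 - w * starRingEnd ℂ a‖ ^ 2 = ‖w - a‖ ^ 2 := by linarith
        exact (pow_left_inj₀ (norm_nonneg _) (norm_nonneg _) two_ne_zero).1 h2
    · have ha0 : a ≠ 0 := by
        rintro rfl
        simp at ha
        linarith
      obtain ⟨hd, hn⟩ := key a⁻¹ (by rw [norm_inv]; exact inv_le_one_of_one_le₀ ha.le)
      have heq : ∀ w : ℂ, ‖((‖a‖ ^ p : ℝ) : ℂ) • (1 - w * a⁻¹) ^ (p : ℂ)‖ = ‖w - a‖ ^ p := by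
        intro w
        rw [norm_smul, hn, Complex.norm_real, Real.norm_of_nonneg (by positivity),
          ← Real.mul_rpow (norm_nonneg _) (norm_nonneg _), ← norm_mul]
        congr 1
        rw [← norm_neg]
        congr 1
        field_simp
        ring
      exact ⟨fun w => ((‖a‖ ^ p : ℝ) : ℂ) • (1 - w * a⁻¹) ^ (p : ℂ),
        hd.const_smul ((‖a‖ ^ p : ℝ) : ℂ), fun w _ => (heq w).ge, fun w _ => heq w⟩
  have prod : ∀ s : Multiset ℂ, ∃ h : ℂ → ℂ, DiffContOnCl ℂ h (Metric.ball 0 1) ∧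
      (∀ w ∈ Metric.closedBall (0 : ℂ) 1, ‖(s.map (fun a => w - a)).prod‖ ^ p ≤ ‖h w‖) ∧
      ∀ w ∈ Metric.sphere (0 : ℂ) 1, ‖h w‖ = ‖(s.map (fun a => w - a)).prod‖ ^ p := by
    intro s
    induction s using Multiset.induction with
    | empty => exact ⟨fun _ => 1, diffContOnCl_const, by simp, by simp⟩
    | cons a s ih =>
      obtain ⟨h₁, hd₁, hle₁, heq₁⟩ := linear a
      obtain ⟨h₂, hd₂, hle₂, heq₂⟩ := ih
      refine ⟨fun w => h₁ w • h₂ w, hd₁.smul hd₂, fun w hw => ?_, fun w hw => ?_⟩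
      · rw [Multiset.map_cons, Multiset.prod_cons, norm_mul, norm_smul,
          Real.mul_rpow (norm_nonneg _) (norm_nonneg _)]
        exact mul_le_mul (hle₁ w hw) (hle₂ w hw) (by positivity) (norm_nonneg _)
      · rw [Multiset.map_cons, Multiset.prod_cons, norm_mul, norm_smul,
          Real.mul_rpow (norm_nonneg _) (norm_nonneg _), heq₁ w hw, heq₂ w hw]
  obtain ⟨h, hd, hle, heq⟩ := prod P.roots
  have hnorm : ∀ w : ℂ, ‖P.eval w‖ ^ p =
      ‖P.leadingCoeff‖ ^ p * ‖(P.roots.map (fun a => w - a)).prod‖ ^ p := by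
    intro w
    rw [← Real.mul_rpow (norm_nonneg _) (norm_nonneg _), ← norm_mul,
      (IsAlgClosed.splits P).eval_eq_prod_roots]
  refine ⟨fun w => ((‖P.leadingCoeff‖ ^ p : ℝ) : ℂ) • h w,
    hd.const_smul ((‖P.leadingCoeff‖ ^ p : ℝ) : ℂ), fun w hw => ?_, fun w hw => ?_⟩
  · rw [norm_smul, Complex.norm_real, Real.norm_of_nonneg (by positivity), hnorm]
    exact mul_le_mul_of_nonneg_left (hle w hw) (by positivity)
  · rw [norm_smul, Complex.norm_real, Real.norm_of_nonneg (by positivity), hnorm, heq w hw]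

/-- The function `‖P‖ ^ p * ‖S‖` attached to two polynomials. -/
def weightedNormRpow (P S : Polynomial ℂ) (p : ℝ) (w : ℂ) : ℝ := ‖P.eval w‖ ^ p * ‖S.eval w‖

lemma weightedNormRpow_nonneg (P S : Polynomial ℂ) (p : ℝ) (w : ℂ) :
    0 ≤ weightedNormRpow P S p w := by
  unfold weightedNormRpow
  positivity

lemma continuous_weightedNormRpow (P S : Polynomial ℂ) {p : ℝ} (hp : 0 ≤ p) :
    Continuous (weightedNormRpow P S p) :=
  (P.continuous.norm.rpow_const fun _ => Or.inr hp).mul S.continuous.norm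

lemma continuousOn_poissonKernel_sphere {w : ℂ} (hw : w ∈ Metric.ball (0 : ℂ) 1) :
    ContinuousOn (poissonKernel 0 w) (Metric.sphere 0 |1|) := by
  rw [poissonKernel_eq_re_herglotzRieszKernel]
  exact Complex.continuous_re.comp_continuousOn (continuousOn_herglotzRieszKernel_sphere hw)

lemma poissonKernel_nonneg_of_mem {w z : ℂ} (hw : w ∈ Metric.ball (0 : ℂ) 1)
    (hz : z ∈ Metric.sphere (0 : ℂ) 1) : 0 ≤ poissonKernel 0 w z := by
  have hw' : ‖w‖ < 1 := by simpa using hw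
  have hz' : ‖z‖ = 1 := by simpa using hz
  rw [poissonKernel_def, sub_zero, sub_zero, hz']
  apply div_nonneg _ (by positivity)
  nlinarith [norm_nonneg w]

/-- Sub-mean value property with respect to the Poisson kernel. -/
lemma weightedNormRpow_le_poisson (P S : Polynomial ℂ) {p : ℝ} (hp : 0 < p) {w : ℂ}
    (hw : w ∈ Metric.ball (0 : ℂ) 1) :
    weightedNormRpow P S p w ≤
      Real.circleAverage (fun z => poissonKernel 0 w z * weightedNormRpow P S p z) 0 1 := by
  obtain ⟨h, hd, hle, heq⟩ := exists_diffContOnCl_dominating P hp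
  have hS : DiffContOnCl ℂ (fun w => S.eval w) (Metric.ball 0 1) :=
    S.differentiable.diffContOnCl
  have hP := (hd.smul hS).circleAverage_poissonKernel_smul hw
  have h1 : weightedNormRpow P S p w ≤ ‖h w • S.eval w‖ := by
    rw [norm_smul]
    exact mul_le_mul_of_nonneg_right (hle w (Metric.ball_subset_closedBall hw)) (norm_nonneg _)
  refine h1.trans ?_
  have h2 : ‖h w • S.eval w‖ ≤ Real.circleAverage
      (fun z => ‖(poissonKernel 0 w • (h • fun w => S.eval w)) z‖) 0 1 := by
    rw [← hP, Real.circleAverage_def, Real.circleAverage_def, norm_smul,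
      Real.norm_of_nonneg (by positivity), smul_eq_mul]
    exact mul_le_mul_of_nonneg_left
      (intervalIntegral.norm_integral_le_integral_norm Real.two_pi_pos.le) (by positivity)
  refine h2.trans_eq (Real.circleAverage_congr_sphere fun z hz => ?_)
  rw [abs_one] at hz
  simp only [Pi.smul_apply', norm_smul, weightedNormRpow, heq z hz,
    Real.norm_of_nonneg (poissonKernel_nonneg_of_mem hw hz)]

lemma circleIntegrable_poisson_mul (P S : Polynomial ℂ) {p : ℝ} (hp : 0 < p) {w : ℂ}
    (hw : w ∈ Metric.ball (0 : ℂ) 1) :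
    CircleIntegrable (fun z => poissonKernel 0 w z * weightedNormRpow P S p z) 0 1 := by
  apply ContinuousOn.circleIntegrable'
  exact (continuousOn_poissonKernel_sphere hw).mul
    (continuous_weightedNormRpow P S hp.le).continuousOn

/-- Circle averages of `‖P‖ ^ p * ‖S‖` over circles around `0` increase with the radius. -/
lemma circleAverage_weightedNormRpow_le (P S : Polynomial ℂ) {p : ℝ} (hp : 0 < p) {r : ℝ}
    (hr0 : 0 ≤ r) (hr : r < 1) :
    Real.circleAverage (weightedNormRpow P S p) 0 r ≤
      Real.circleAverage (weightedNormRpow P S p) 0 1 := by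
  set F := weightedNormRpow P S p with hF
  have hFc : Continuous F := continuous_weightedNormRpow P S hp.le
  have hmem : ∀ θ : ℝ, circleMap 0 r θ ∈ Metric.ball (0 : ℂ) 1 := by
    intro θ
    simpa [abs_of_nonneg hr0] using hr
  have hne : ∀ θ φ : ℝ, ‖circleMap 0 1 φ - circleMap 0 r θ‖ ≠ 0 := by
    intro θ φ h0
    have h1 := norm_sub_norm_le (circleMap 0 1 φ) (circleMap 0 r θ)
    rw [h0] at h1
    simp [abs_of_nonneg hr0] at h1
    linarith
  have hker : ∀ θ φ : ℝ, poissonKernel 0 (circleMap 0 r θ) (circleMap 0 1 φ)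
      = poissonKernel 0 (circleMap 0 r φ) (circleMap 0 1 θ) := by
    intro θ φ
    simp only [poissonKernel_def, sub_zero, norm_circleMap_zero]
    congr 2
    apply (pow_left_inj₀ (norm_nonneg _) (norm_nonneg _) two_ne_zero).1
    simp only [circleMap, zero_add, Complex.sq_norm, Complex.normSq_apply, Complex.sub_re,
      Complex.sub_im, Complex.re_ofReal_mul, Complex.im_ofReal_mul, Complex.exp_ofReal_mul_I_re,
      Complex.exp_ofReal_mul_I_im]
    linear_combination (1 - r ^ 2) * (Real.sin_sq_add_cos_sq φ)
      - (1 - r ^ 2) * (Real.sin_sq_add_cos_sq θ)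
  have hone : ∀ φ : ℝ, ∫ θ in (0 : ℝ)..2 * Real.pi,
      poissonKernel 0 (circleMap 0 r φ) (circleMap 0 1 θ) = 2 * Real.pi := by
    intro φ
    have h1 := (diffContOnCl_const (𝕜 := ℂ) (c := (1 : ℂ))
      (s := Metric.ball (0 : ℂ) 1)).circleAverage_poissonKernel_smul (hmem φ)
    rw [Real.circleAverage_def] at h1
    have h3 : (∫ θ in (0 : ℝ)..2 * Real.pi,
        (poissonKernel 0 (circleMap 0 r φ) • fun _ : ℂ => (1 : ℂ)) (circleMap 0 1 θ))
        = ((∫ θ in (0 : ℝ)..2 * Real.pi,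
          poissonKernel 0 (circleMap 0 r φ) (circleMap 0 1 θ) : ℝ) : ℂ) := by
      rw [← intervalIntegral.integral_ofReal]
      apply intervalIntegral.integral_congr
      intro θ _
      simp
    rw [h3] at h1
    have h4 : (2 * Real.pi)⁻¹ * (∫ θ in (0 : ℝ)..2 * Real.pi,
          poissonKernel 0 (circleMap 0 r φ) (circleMap 0 1 θ)) = 1 := by
      rw [Complex.real_smul] at h1
      exact_mod_cast h1
    have := Real.pi_pos
    field_simp at h4
    linarith
  have hkc : Continuous fun x : ℝ × ℝ =>
      poissonKernel 0 (circleMap 0 r x.1) (circleMap 0 1 x.2) := by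
    simp only [poissonKernel_def, sub_zero]
    apply Continuous.div
    · fun_prop
    · fun_prop
    · intro x
      exact pow_ne_zero 2 (hne x.1 x.2)
  have hc : Continuous fun x : ℝ × ℝ =>
      poissonKernel 0 (circleMap 0 r x.1) (circleMap 0 1 x.2) * F (circleMap 0 1 x.2) := by
    apply hkc.mul
    exact hFc.comp (by fun_prop)
  calc Real.circleAverage F 0 r
      ≤ (2 * Real.pi)⁻¹ * ∫ θ in (0 : ℝ)..2 * Real.pi, ((2 * Real.pi)⁻¹ *
        ∫ φ in (0 : ℝ)..2 * Real.pi,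
          poissonKernel 0 (circleMap 0 r θ) (circleMap 0 1 φ) * F (circleMap 0 1 φ)) := by
        rw [Real.circleAverage_def, smul_eq_mul]
        apply mul_le_mul_of_nonneg_left _ (by positivity)
        apply intervalIntegral.integral_mono_on Real.two_pi_pos.le
        · exact (hFc.comp (by fun_prop)).intervalIntegrable _ _
        · apply Continuous.intervalIntegrable
          apply continuous_const.mul
          exact intervalIntegral.continuous_parametric_intervalIntegral_of_continuous' hc _ _
        · intro θ _
          have := weightedNormRpow_le_poisson P S hp (hmem θ)
          rwa [Real.circleAverage_def, smul_eq_mul] at this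
    _ = (2 * Real.pi)⁻¹ * ((2 * Real.pi)⁻¹ * ∫ φ in (0 : ℝ)..2 * Real.pi,
        ∫ θ in (0 : ℝ)..2 * Real.pi,
          poissonKernel 0 (circleMap 0 r θ) (circleMap 0 1 φ) * F (circleMap 0 1 φ)) := by
        rw [intervalIntegral.integral_const_mul, intervalIntegral_intervalIntegral_swap]
        exact (hc.continuousOn.integrableOn_compact (isCompact_uIcc.prod isCompact_uIcc)).mono_set
          (prod_mono uIoc_subset_uIcc uIoc_subset_uIcc)
    _ = (2 * Real.pi)⁻¹ * ((2 * Real.pi)⁻¹ * ∫ φ in (0 : ℝ)..2 * Real.pi,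
          (2 * Real.pi) * F (circleMap 0 1 φ)) := by
        congr 2
        apply intervalIntegral.integral_congr
        intro φ _
        simp only
        rw [intervalIntegral.integral_mul_const]
        simp_rw [hker _ φ]
        rw [hone]
    _ = Real.circleAverage F 0 1 := by
        rw [intervalIntegral.integral_const_mul, Real.circleAverage_def, smul_eq_mul,
          inv_mul_cancel_left₀ Real.two_pi_pos.ne']

/-- A mean value inequality on the concentric disc of half the radius. -/
lemma weightedNormRpow_le_circleAverage (P S : Polynomial ℂ) {p : ℝ} (hp : 0 < p) {c w : ℂ}
    {s : ℝ} (hs : 0 < s) (hw : ‖w - c‖ ≤ s / 2) :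
    weightedNormRpow P S p w ≤ 3 * Real.circleAverage (weightedNormRpow P S p) c s := by
  set q : Polynomial ℂ := Polynomial.C (s : ℂ) * Polynomial.X + Polynomial.C c with hq
  have hcomp : ∀ z, weightedNormRpow (P.comp q) (S.comp q) p z
      = weightedNormRpow P S p (s * z + c) := by
    intro z
    simp [weightedNormRpow, hq]
  have hs' : (s : ℂ) ≠ 0 := by exact_mod_cast hs.ne'
  set v : ℂ := (w - c) / s with hv
  have hvn : ‖v‖ ≤ 1 / 2 := by
    rw [hv, norm_div, Complex.norm_real, Real.norm_of_nonneg hs.le, div_le_iff₀ hs]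
    linarith
  have hvm : v ∈ Metric.ball (0 : ℂ) 1 := by
    simp only [Metric.mem_ball, dist_zero_right]
    linarith
  have h1 := weightedNormRpow_le_poisson (P.comp q) (S.comp q) hp hvm
  rw [hcomp] at h1
  have h2 : (s : ℂ) * v + c = w := by rw [hv]; field_simp; ring
  rw [h2] at h1
  refine h1.trans ?_
  rw [Real.circleAverage_eq_circleAverage_zero_one (R := s), ← smul_eq_mul,
    ← Real.circleAverage_fun_smul]
  apply Real.circleAverage_mono
  · exact circleIntegrable_poisson_mul _ _ hp hvm
  · apply ContinuousOn.circleIntegrable'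
    have hF : Continuous fun z : ℂ => weightedNormRpow P S p (s * z + c) :=
      (continuous_weightedNormRpow P S hp.le).comp (by fun_prop)
    exact (hF.const_smul (3 : ℝ)).continuousOn
  · intro z hz
    rw [abs_one] at hz
    rw [hcomp, smul_eq_mul]
    apply mul_le_mul_of_nonneg_right _ (weightedNormRpow_nonneg _ _ _ _)
    have h3 := re_herglotzRieszKernel_le hz hvm
    have h4 : poissonKernel 0 v z = ((z - 0 + (v - 0)) / ((z - 0) - (v - 0))).re := by
      rw [poissonKernel_eq_re_herglotzRieszKernel]
      rfl
    rw [h4]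
    refine h3.trans ?_
    rw [sub_zero, div_le_iff₀ (by linarith)]
    linarith

/-- The rational parametrisation of the plane which maps the unit circle onto `[0, 1]`. -/
def joukowski (w : ℂ) : ℂ := -(1 - w) ^ 2 / (4 * w)

lemma joukowski_inv (w : ℂ) : joukowski w⁻¹ = joukowski w := by
  rcases eq_or_ne w 0 with rfl | hw
  · simp [joukowski]
  · unfold joukowski
    field_simp
    ring

/-- The polynomial agreeing with `w ^ n * Q (joukowski w)` away from `0`. -/
def joukowskiPullback (n : ℕ) (Q : Polynomial ℂ) : Polynomial ℂ :=
  ∑ k ∈ Finset.range (n + 1), Polynomial.C (Q.coeff k) *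
    (Polynomial.C (-1 / 4) * (1 - Polynomial.X) ^ 2) ^ k * Polynomial.X ^ (n - k)

lemma eval_joukowskiPullback {n : ℕ} {Q : Polynomial ℂ} (hQ : Q.natDegree ≤ n) {w : ℂ}
    (hw : w ≠ 0) :
    (joukowskiPullback n Q).eval w = w ^ n * Q.eval (joukowski w) := by
  rw [Polynomial.eval_eq_sum_range' (Nat.lt_succ_of_le hQ), joukowskiPullback,
    Polynomial.eval_finsetSum, Finset.mul_sum]
  apply Finset.sum_congr rfl
  intro k hk
  have hk' : k ≤ n := Nat.lt_succ_iff.1 (Finset.mem_range.1 hk)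
  obtain ⟨m, rfl⟩ := Nat.exists_eq_add_of_le hk'
  simp only [Polynomial.eval_mul, Polynomial.eval_pow, Polynomial.eval_C, Polynomial.eval_sub,
    Polynomial.eval_one, Polynomial.eval_X, joukowski, Nat.add_sub_cancel_left]
  rw [show -(1 - w) ^ 2 / (4 * w) = (-1 / 4 * (1 - w) ^ 2) / w by field_simp, div_pow, pow_add]
  field_simp

/-- The weighted power `‖P‖ ^ p * ‖w ^ 2 - 1‖` for the pullback `P` of `Q`. -/
abbrev pullbackWeight (n : ℕ) (Q : Polynomial ℂ) (p : ℝ) : ℂ → ℝ :=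
  weightedNormRpow (joukowskiPullback n Q) (Polynomial.X ^ 2 - 1) p

lemma pullbackWeight_eq {n : ℕ} {Q : Polynomial ℂ} (hQ : Q.natDegree ≤ n) (p : ℝ) {w : ℂ}
    (hw : w ≠ 0) :
    pullbackWeight n Q p w = (‖w‖ ^ n) ^ p * ‖Q.eval (joukowski w)‖ ^ p * ‖w ^ 2 - 1‖ := by
  rw [pullbackWeight, weightedNormRpow, eval_joukowskiPullback hQ hw, norm_mul, norm_pow,
    Real.mul_rpow (by positivity) (by positivity)]
  simp

lemma pullbackWeight_inv {n : ℕ} {Q : Polynomial ℂ} (hQ : Q.natDegree ≤ n) (p : ℝ) {w : ℂ}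
    (hw : w ≠ 0) :
    pullbackWeight n Q p w = (‖w‖ ^ (2 * n)) ^ p * ‖w‖ ^ 2 * pullbackWeight n Q p w⁻¹ := by
  rw [pullbackWeight_eq hQ p hw, pullbackWeight_eq hQ p (inv_ne_zero hw), joukowski_inv]
  have h1 : ‖w⁻¹ ^ 2 - 1‖ * ‖w‖ ^ 2 = ‖w ^ 2 - 1‖ := by
    rw [← norm_pow, ← norm_mul, ← norm_neg]
    congr 1
    field_simp
    ring
  have hw' : 0 < ‖w‖ := norm_pos_iff.2 hw
  have h2 : (‖w‖ ^ (2 * n)) ^ p * (‖w⁻¹‖ ^ n) ^ p = (‖w‖ ^ n) ^ p := by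
    rw [← Real.mul_rpow (by positivity) (by positivity), norm_inv]
    congr 1
    rw [two_mul, pow_add, inv_pow]
    field_simp
  rw [← h1, ← h2]
  ring

lemma one_add_pow_two_mul_le {n : ℕ} (hn : 0 < n) {r : ℝ} (hr0 : 0 ≤ r)
    (hr : r ≤ 1 + 1 / (2 * n)) : r ^ (2 * n) ≤ 3 := by
  have hn' : (0 : ℝ) < n := by exact_mod_cast hn
  have h1 : r ≤ Real.exp (1 / (2 * n)) := by
    have := Real.add_one_le_exp (1 / (2 * (n : ℝ)))
    linarith
  calc r ^ (2 * n) ≤ Real.exp (1 / (2 * n)) ^ (2 * n) := pow_le_pow_left₀ hr0 h1 _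
    _ = Real.exp 1 := by
        rw [← Real.exp_nat_mul]
        congr 1
        push_cast
        field_simp
    _ ≤ 3 := Real.exp_one_lt_three.le

lemma circleAverage_pullbackWeight_le {n : ℕ} (hn : 0 < n) {Q : Polynomial ℂ}
    (hQ : Q.natDegree ≤ n) {p : ℝ} (hp : 0 < p) {r : ℝ} (hr0 : 0 ≤ r)
    (hr : r ≤ 1 + 1 / (2 * n)) :
    Real.circleAverage (pullbackWeight n Q p) 0 r ≤
      3 ^ p * 3 * Real.circleAverage (pullbackWeight n Q p) 0 1 := by
  have hA : 0 ≤ Real.circleAverage (pullbackWeight n Q p) 0 1 :=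
    Real.circleAverage_nonneg_of_nonneg fun z _ => weightedNormRpow_nonneg _ _ _ _
  have hK : (1 : ℝ) ≤ 3 ^ p * 3 := by
    have : (1 : ℝ) ≤ 3 ^ p := Real.one_le_rpow (by norm_num) hp.le
    linarith
  rcases lt_or_ge r 1 with h1 | h1
  · exact (circleAverage_weightedNormRpow_le _ _ hp hr0 h1).trans (le_mul_of_one_le_left hA hK)
  have hrp : 0 < r := by linarith
  have hle : Real.circleAverage (pullbackWeight n Q p) 0 r⁻¹ ≤
      Real.circleAverage (pullbackWeight n Q p) 0 1 := by
    rcases h1.eq_or_lt with h | h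
    · rw [← h, inv_one]
    · exact circleAverage_weightedNormRpow_le _ _ hp (by positivity) (inv_lt_one_of_one_lt₀ h)
  have heq : Real.circleAverage (pullbackWeight n Q p) 0 r
      = (r ^ (2 * n)) ^ p * r ^ 2 * Real.circleAverage (pullbackWeight n Q p) 0 r⁻¹ := by
    rw [Real.circleAverage_eq_circleAverage_zero_one (R := r),
      Real.circleAverage_eq_circleAverage_zero_one (R := r⁻¹), ← smul_eq_mul,
      ← Real.circleAverage_fun_smul,
      ← Real.circleAverage_zero_one_congr_inv (f := fun z => _ • pullbackWeight n Q p (_ * z + 0))]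
    apply Real.circleAverage_congr_sphere
    intro z hz
    have hz1 : ‖z‖ = 1 := by simpa using hz
    have hz0 : z ≠ 0 := by
      rintro rfl
      simp at hz1
    have hr' : (r : ℂ) ≠ 0 := by exact_mod_cast hrp.ne'
    simp only [add_zero, smul_eq_mul]
    rw [pullbackWeight_inv hQ p (mul_ne_zero hr' hz0), norm_mul, hz1, mul_one, Complex.norm_real,
      Real.norm_of_nonneg hr0, mul_inv, Complex.ofReal_inv]
  rw [heq]
  apply mul_le_mul _ hle _ (by positivity)
  · have h3 := one_add_pow_two_mul_le hn hr0 hr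
    apply mul_le_mul (Real.rpow_le_rpow (by positivity) h3 hp.le) _ (by positivity) (by positivity)
    refine le_trans (pow_le_pow_right₀ h1 ?_) h3
    omega
  · exact Real.circleAverage_nonneg_of_nonneg fun z _ => weightedNormRpow_nonneg _ _ _ _

lemma circleAverage_mul_right (F : ℂ → ℝ) (v : ℂ) :
    Real.circleAverage (fun z => F (z * v)) 0 1 = Real.circleAverage F 0 ‖v‖ := by
  rw [Real.circleAverage_eq_integral_add (f := F) v.arg, Real.circleAverage_def]
  congr 2
  ext θ
  congr 1
  conv_lhs => rw [← Complex.norm_mul_exp_arg_mul_I v]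
  simp only [circleMap, zero_add, Complex.ofReal_one, one_mul, Complex.ofReal_add, add_mul,
    Complex.exp_add]
  ring

/-- Average of `F` over a small circle around the point `w` of the unit circle. -/
def localAverage (F : ℂ → ℝ) (n : ℕ) (w : ℂ) : ℝ :=
  Real.circleAverage (fun v => F (w * v)) 1 (1 / (2 * n))

lemma localAverage_nonneg {F : ℂ → ℝ} (hF : ∀ z, 0 ≤ F z) (n : ℕ) (w : ℂ) :
    0 ≤ localAverage F n w :=
  Real.circleAverage_nonneg_of_nonneg fun _ _ => hF _

lemma continuous_localAverage {F : ℂ → ℝ} (hF : Continuous F) (n : ℕ) :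
    Continuous (localAverage F n) := by
  unfold localAverage Real.circleAverage
  have hc : Continuous fun x : ℂ × ℝ => F (x.1 * circleMap 1 (1 / (2 * n)) x.2) :=
    hF.comp (by fun_prop)
  have h : Continuous fun w => ∫ θ in (0 : ℝ)..2 * Real.pi, F (w * circleMap 1 (1 / (2 * n)) θ) :=
    intervalIntegral.continuous_parametric_intervalIntegral_of_continuous' hc _ _
  exact h.const_smul (2 * Real.pi)⁻¹

lemma circleAverage_localAverage_le {n : ℕ} (hn : 0 < n) {Q : Polynomial ℂ}
    (hQ : Q.natDegree ≤ n) {p : ℝ} (hp : 0 < p) :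
    Real.circleAverage (localAverage (pullbackWeight n Q p) n) 0 1 ≤
      3 ^ p * 3 * Real.circleAverage (pullbackWeight n Q p) 0 1 := by
  set F := pullbackWeight n Q p with hF
  have hFc : Continuous F := continuous_weightedNormRpow _ _ hp.le
  set s : ℝ := 1 / (2 * n) with hs
  have hs0 : 0 ≤ s := by positivity
  have hc : Continuous fun x : ℝ × ℝ => F (circleMap 0 1 x.1 * circleMap 1 s x.2) :=
    hFc.comp (by fun_prop)
  have hswap : Real.circleAverage (localAverage F n) 0 1 =
      Real.circleAverage (fun v => Real.circleAverage (fun z => F (z * v)) 0 1) 1 s := by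
    unfold localAverage Real.circleAverage
    simp only [smul_eq_mul, intervalIntegral.integral_const_mul]
    congr 2
    exact intervalIntegral_intervalIntegral_swap
      ((hc.continuousOn.integrableOn_compact (isCompact_uIcc.prod isCompact_uIcc)).mono_set
        (prod_mono uIoc_subset_uIcc uIoc_subset_uIcc))
  rw [hswap]
  simp_rw [circleAverage_mul_right]
  apply Real.circleAverage_mono_on_of_le_circle
  · apply ContinuousOn.circleIntegrable'
    exact ((Real.Continuous.circleAverage hFc).comp continuous_norm).continuousOn
  · intro v hv
    apply circleAverage_pullbackWeight_le hn hQ hp (norm_nonneg _)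
    have h1 : ‖v - 1‖ = s := by simpa [abs_of_nonneg hs0, dist_eq_norm] using hv
    calc ‖v‖ = ‖1 + (v - 1)‖ := by ring_nf
      _ ≤ 1 + s := by
        refine (norm_add_le _ _).trans ?_
        rw [h1, norm_one]

lemma weightedNormRpow_le_localAverage (P S : Polynomial ℂ) {p : ℝ} (hp : 0 < p) {n : ℕ}
    (hn : 0 < n) {w w₀ : ℂ} (hw₀ : ‖w₀‖ = 1) (hw : ‖w - w₀‖ ≤ 1 / (4 * n)) :
    weightedNormRpow P S p w ≤ 3 * localAverage (weightedNormRpow P S p) n w₀ := by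
  have hn' : (0 : ℝ) < n := by exact_mod_cast hn
  have hw0 : w₀ ≠ 0 := by
    rintro rfl
    simp at hw₀
  set q : Polynomial ℂ := Polynomial.C w₀ * Polynomial.X with hq
  have hcomp : weightedNormRpow (P.comp q) (S.comp q) p
      = fun v => weightedNormRpow P S p (w₀ * v) := by
    ext v
    simp [weightedNormRpow, hq]
  have h1 := weightedNormRpow_le_circleAverage (P.comp q) (S.comp q) hp (c := 1) (w := w / w₀)
    (s := 1 / (2 * n)) (by positivity) (by
      have : w / w₀ - 1 = (w - w₀) / w₀ := by field_simp
      rw [this, norm_div, hw₀, div_one]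
      refine hw.trans_eq ?_
      field_simp
      norm_num)
  rw [hcomp] at h1
  simpa only [mul_div_cancel₀ w hw0, localAverage] using h1

lemma exists_joukowski_eq (z : ℂ) : ∃ w : ℂ, w ≠ 0 ∧ ‖w‖ ≤ 1 ∧ joukowski w = z := by
  obtain ⟨d, hd⟩ := IsAlgClosed.exists_pow_nat_eq ((1 - 2 * z) ^ 2 - 1) (n := 2) (by norm_num)
  set u : ℂ := (1 - 2 * z) + d with hu
  set v : ℂ := (1 - 2 * z) - d with hv
  have huv : u * v = 1 := by
    rw [hu, hv]
    linear_combination -hd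
  have hu0 : u ≠ 0 := left_ne_zero_of_mul_eq_one huv
  have hv0 : v ≠ 0 := right_ne_zero_of_mul_eq_one huv
  have hju : joukowski u = z := by
    unfold joukowski
    rw [div_eq_iff (mul_ne_zero (by norm_num) hu0), hu]
    linear_combination -hd
  have hjv : joukowski v = z := by
    unfold joukowski
    rw [div_eq_iff (mul_ne_zero (by norm_num) hv0), hv]
    linear_combination -hd
  rcases le_or_gt ‖u‖ 1 with h | h
  · exact ⟨u, hu0, h, hju⟩
  · refine ⟨v, hv0, ?_, hjv⟩
    have : ‖u‖ * ‖v‖ = 1 := by rw [← norm_mul, huv, norm_one]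
    nlinarith [norm_nonneg v]

lemma joukowski_circleMap (θ : ℝ) :
    joukowski (circleMap 0 1 θ) = ((Real.sin (θ / 2) ^ 2 : ℝ) : ℂ) := by
  have h0 : circleMap 0 1 θ ≠ 0 := by simp [circleMap]
  unfold joukowski
  rw [div_eq_iff (mul_ne_zero (by norm_num) h0)]
  have h1 : Real.sin (θ / 2) ^ 2 = (1 - Real.cos θ) / 2 := by
    have h2 := Real.cos_two_mul (θ / 2)
    rw [mul_div_cancel₀ θ two_ne_zero] at h2
    have := Real.sin_sq_add_cos_sq (θ / 2)
    linarith
  rw [h1]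
  have h3 := Complex.sin_sq_add_cos_sq (θ : ℂ)
  simp only [circleMap, zero_add, Complex.ofReal_one, one_mul, Complex.exp_mul_I]
  push_cast
  linear_combination h3 - Complex.sin θ ^ 2 * Complex.I_sq

/-- Distance identity for the two points of the unit circle over a point of `[0, 1]`. -/
lemma norm_joukowski_sub {w w₀ : ℂ} (hw : w ≠ 0) (hw₀ : ‖w₀‖ = 1) :
    ‖w - w₀‖ * ‖w - w₀⁻¹‖ = 4 * ‖w‖ * ‖joukowski w - joukowski w₀‖ := by
  have h0 : w₀ ≠ 0 := by
    rintro rfl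
    simp at hw₀
  have h : (w - w₀) * (w - w₀⁻¹) = -(4 * w) * (joukowski w - joukowski w₀) := by
    unfold joukowski
    field_simp
    ring
  rw [← norm_mul, h]
  simp

set_option maxHeartbeats 1000000 in
/-- Points of the circle of suitable radius comparable with `√t / n + 1 / n ^ 2` around
`t = sin² (θ / 2)` lift to points close to the unit circle and away from `±1`. -/
lemma exists_radius_lift {μ : ℝ} (hμ1 : μ < 1) {n : ℕ} (hn : 0 < n) {θ : ℝ}
    (hθ0 : 0 ≤ θ) (hθ1 : θ ≤ Real.pi) (hθ : Real.sin (θ / 2) ^ 2 ≤ μ) :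
    ∃ ρ : ℝ, (1 - μ) / 256 * ((Real.sin (θ / 2) + 1 / n) / n) ≤ ρ ∧
      ∀ z : ℂ, ‖z - ((Real.sin (θ / 2) ^ 2 : ℝ) : ℂ)‖ = ρ → ∃ w : ℂ, w ≠ 0 ∧ ‖w‖ ≤ 1 ∧
        joukowski w = z ∧ 1 / 2 ≤ ‖w‖ ^ n ∧ (1 - μ) / 2 * Real.sin θ ≤ ‖w ^ 2 - 1‖ ∧
        (‖w - circleMap 0 1 θ‖ ≤ 1 / (4 * n) ∨ ‖w - (circleMap 0 1 θ)⁻¹‖ ≤ 1 / (4 * n)) := by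
  have hn' : (1 : ℝ) ≤ n := by exact_mod_cast hn
  set u := Real.sin (θ / 2) with hu
  have hu0 : 0 ≤ u := Real.sin_nonneg_of_nonneg_of_le_pi (by linarith) (by linarith)
  have hu1 : u ≤ 1 := Real.sin_le_one _
  have hμ0 : 0 ≤ μ := (sq_nonneg u).trans hθ
  set ε : ℝ := 1 / n with hε
  have hε0 : 0 < ε := by positivity
  have hε1 : ε ≤ 1 := by rw [hε, div_le_one (by linarith)]; exact hn'
  set ρ₀ : ℝ := (1 - μ) / 128 * ((u + ε) * ε) with hρ₀
  have hρ₀0 : 0 < ρ₀ := by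
    have : 0 < 1 - μ := by linarith
    positivity
  obtain ⟨ρ, hρl, hρu, hρt⟩ : ∃ ρ, ρ₀ / 2 ≤ ρ ∧ ρ ≤ ρ₀ ∧ u ^ 2 / 3 ≤ |u ^ 2 - ρ| := by
    by_cases h : u ^ 2 / 3 ≤ |u ^ 2 - ρ₀|
    · exact ⟨ρ₀, by linarith, le_rfl, h⟩
    · refine ⟨ρ₀ / 2, le_rfl, by linarith, ?_⟩
      rw [not_le, abs_lt] at h
      rw [le_abs]
      left
      linarith [h.1]
  refine ⟨ρ, ?_, fun z hz => ?_⟩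
  · have : (1 - μ) / 256 * ((u + ε) / n) = ρ₀ / 2 := by
      rw [hρ₀, hε]
      ring
    rw [this]
    exact hρl
  obtain ⟨w, hw0, hw1, hwz⟩ := exists_joukowski_eq z
  set w₀ := circleMap 0 1 θ with hw₀
  have hw₀n : ‖w₀‖ = 1 := by simp [hw₀]
  have hprod : ‖w - w₀‖ * ‖w - w₀⁻¹‖ ≤ 4 * ρ₀ := by
    rw [norm_joukowski_sub hw0 hw₀n, hwz, hw₀, joukowski_circleMap, hz]
    have : 0 ≤ ρ := by linarith
    nlinarith [norm_nonneg w]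
  have hsin : Real.sin θ = 2 * u * Real.cos (θ / 2) := by
    rw [hu, ← Real.sin_two_mul]
    congr 1
    ring
  have hcos0 : 0 ≤ Real.cos (θ / 2) :=
    Real.cos_nonneg_of_neg_pi_div_two_le_of_le (by linarith [Real.pi_pos]) (by linarith)
  have hcos : 1 - μ ≤ Real.cos (θ / 2) := by
    have h1 := Real.sin_sq_add_cos_sq (θ / 2)
    have h2 := Real.cos_le_one (θ / 2)
    rw [← hu] at h1
    nlinarith
  have hdiff : 4 * (u * (1 - μ)) ≤ ‖w - w₀‖ + ‖w - w₀⁻¹‖ := by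
    have h1 : ‖w₀ - w₀⁻¹‖ ≤ ‖w - w₀‖ + ‖w - w₀⁻¹‖ := by
      have := norm_sub_le (w - w₀⁻¹) (w - w₀)
      rw [sub_sub_sub_cancel_left] at this
      linarith
    have h2 : 2 * Real.sin θ ≤ ‖w₀ - w₀⁻¹‖ := by
      have h3 : (w₀ - w₀⁻¹).im = 2 * Real.sin θ := by
        rw [hw₀, circleMap_zero_inv, inv_one]
        simp only [circleMap, zero_add, Complex.ofReal_one, one_mul, Complex.sub_im,
          Complex.exp_ofReal_mul_I_im, Real.sin_neg]
        ring
      rw [← h3]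
      exact Complex.im_le_norm _
    nlinarith
  have hnear : ‖w - w₀‖ ≤ 1 / (4 * n) ∨ ‖w - w₀⁻¹‖ ≤ 1 / (4 * n) := by
    have he : 1 / (4 * (n : ℝ)) = ε / 4 := by rw [hε]; field_simp
    rw [he]
    by_contra! hcon
    obtain ⟨h1, h2⟩ := hcon
    have h3 : (ε / 4) * (ε / 4) < ‖w - w₀‖ * ‖w - w₀⁻¹‖ :=
      mul_lt_mul'' h1 h2 (by positivity) (by positivity)
    have h4 : (ε / 4) * (2 * (u * (1 - μ))) ≤ ‖w - w₀‖ * ‖w - w₀⁻¹‖ := by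
      rcases le_total ‖w - w₀‖ ‖w - w₀⁻¹‖ with h | h
      · apply mul_le_mul h1.le (by linarith) _ (norm_nonneg _)
        have : 0 ≤ 1 - μ := by linarith
        positivity
      · rw [mul_comm]
        apply mul_le_mul (by linarith) h2.le (by positivity) (norm_nonneg _)
    have h5 : 4 * ρ₀ = (1 - μ) * (u * ε) / 32 + (1 - μ) * ε ^ 2 / 32 := by rw [hρ₀]; ring
    have h6 : 0 ≤ (1 - μ) * (u * ε) := by
      have : 0 ≤ 1 - μ := by linarith
      positivity
    have h7 : (1 - μ) * ε ^ 2 ≤ ε ^ 2 := by nlinarith [sq_nonneg ε]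
    nlinarith
  have hwlow : 1 - 1 / (4 * n) ≤ ‖w‖ := by
    rcases hnear with h | h
    · have := norm_sub_norm_le w₀ w
      rw [norm_sub_rev, hw₀n] at this
      linarith
    · have := norm_sub_norm_le w₀⁻¹ w
      rw [norm_sub_rev, norm_inv, hw₀n, inv_one] at this
      linarith
  have h4n : 1 / (4 * (n : ℝ)) ≤ 1 / 4 := by
    apply one_div_le_one_div_of_le <;> linarith
  refine ⟨w, hw0, hw1, hwz, ?_, ?_, hnear⟩
  · have hb := one_add_mul_le_pow (a := -(1 / (4 * (n : ℝ)))) (by linarith) n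
    have h1 : (1 + -(1 / (4 * (n : ℝ)))) ^ n ≤ ‖w‖ ^ n :=
      pow_le_pow_left₀ (by linarith) (by linarith) n
    have h2 : (n : ℝ) * -(1 / (4 * (n : ℝ))) = -(1 / 4) := by field_simp
    linarith
  · have hz1 : u ^ 2 / 3 ≤ ‖z‖ := by
      refine hρt.trans ?_
      have h1 := abs_norm_sub_norm_le ((u ^ 2 : ℝ) : ℂ) (((u ^ 2 : ℝ) : ℂ) - z)
      rw [norm_sub_rev ((u ^ 2 : ℝ) : ℂ) z, hz, sub_sub_cancel, Complex.norm_real,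
        Real.norm_of_nonneg (sq_nonneg u)] at h1
      exact h1
    have hz2 : (1 - μ) / 2 ≤ ‖1 - z‖ := by
      have h1 := norm_sub_norm_le ((1 - u ^ 2 : ℝ) : ℂ) (z - ((u ^ 2 : ℝ) : ℂ))
      have h2 : ((1 - u ^ 2 : ℝ) : ℂ) - (z - ((u ^ 2 : ℝ) : ℂ)) = 1 - z := by push_cast; ring
      rw [h2, hz, Complex.norm_real] at h1
      have h3 := le_abs_self (1 - u ^ 2)
      rw [Real.norm_eq_abs] at h1
      have h4 : (u + ε) * ε ≤ 2 := by nlinarith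
      have h5 : ρ₀ ≤ (1 - μ) / 64 := by
        rw [hρ₀]
        nlinarith
      linarith
    have hfac : ‖w ^ 2 - 1‖ ^ 2 = 16 * ‖w‖ ^ 2 * (‖z‖ * ‖1 - z‖) := by
      have h1 : (w ^ 2 - 1) ^ 2 = -(16 * w ^ 2 * (z * (1 - z))) := by
        rw [← hwz]
        unfold joukowski
        field_simp
        ring
      rw [← norm_pow, h1]
      simp
    have hwsq : (3 / 4 : ℝ) ^ 2 ≤ ‖w‖ ^ 2 := pow_le_pow_left₀ (by norm_num) (by linarith) 2
    have hzz : u ^ 2 / 3 * ((1 - μ) / 2) ≤ ‖z‖ * ‖1 - z‖ :=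
      mul_le_mul hz1 hz2 (by linarith) (norm_nonneg _)
    have hlow : 9 * (u ^ 2 / 3 * ((1 - μ) / 2)) ≤ ‖w ^ 2 - 1‖ ^ 2 := by
      rw [hfac]
      have h0 : 0 ≤ ‖z‖ * ‖1 - z‖ := by positivity
      nlinarith
    have hs : Real.sin θ ^ 2 ≤ 4 * u ^ 2 := by
      rw [hsin]
      have h2 := Real.cos_le_one (θ / 2)
      have h3 : Real.cos (θ / 2) ^ 2 ≤ 1 := by nlinarith
      nlinarith [sq_nonneg u]
    have hsin0 : 0 ≤ Real.sin θ := Real.sin_nonneg_of_nonneg_of_le_pi hθ0 hθ1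
    refine (sq_le_sq₀ (mul_nonneg (by linarith) hsin0) (norm_nonneg _)).1 ?_
    refine le_trans ?_ hlow
    have h8 : ((1 - μ) / 2 * Real.sin θ) ^ 2 ≤ (1 - μ) ^ 2 * u ^ 2 := by
      have : 0 ≤ (1 - μ) ^ 2 := sq_nonneg _
      nlinarith
    have h9 : (1 - μ) ^ 2 ≤ 1 - μ := by nlinarith
    nlinarith [sq_nonneg u]

lemma iteratedDeriv_polynomial_eval {𝕜 : Type*} [NontriviallyNormedField 𝕜] (k : ℕ)
    (Q : Polynomial 𝕜) :
    iteratedDeriv k (fun z => Q.eval z) = fun z => (Polynomial.derivative^[k] Q).eval z := by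
  induction k with
  | zero => simp
  | succ k ih =>
    rw [iteratedDeriv_succ, ih, Function.iterate_succ_apply']
    ext z
    exact Polynomial.deriv _

lemma exists_norm_eval_iterate_derivative_le (Q : Polynomial ℂ) (k : ℕ) (t : ℂ) {ρ : ℝ}
    (hρ : 0 < ρ) :
    ∃ z, ‖z - t‖ = ρ ∧
      ‖(Polynomial.derivative^[k] Q).eval t‖ ≤ k.factorial * ‖Q.eval z‖ / ρ ^ k := by
  obtain ⟨z, hz, hmax⟩ := (isCompact_sphere t ρ).exists_isMaxOn
    (NormedSpace.sphere_nonempty.2 hρ.le) (f := fun z => ‖Q.eval z‖)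
    (Q.continuous.norm.continuousOn)
  refine ⟨z, mem_sphere_iff_norm.1 hz, ?_⟩
  have h := Complex.norm_iteratedDeriv_le_of_forall_mem_sphere_norm_le (c := t) (R := ρ)
    (f := fun z => Q.eval z) (C := ‖Q.eval z‖) k hρ Q.differentiable.diffContOnCl
    (fun w hw => hmax hw)
  rwa [iteratedDeriv_polynomial_eval] at h

lemma weight_mul_inv_radius_pow_le {c u ρ : ℝ} {n : ℕ} (hc : 0 < c) (hn : 0 < n) (hu : 0 ≤ u)
    (hρ : c * ((u + 1 / n) / n) ≤ ρ) (i j : ℕ) :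
    (u + 1 / n) ^ i / ρ ^ (i + j) ≤ (1 / c) ^ (i + j) * (n : ℝ) ^ (i + 2 * j) := by
  have hn' : (0 : ℝ) < n := by exact_mod_cast hn
  set v : ℝ := u + 1 / n with hv
  have hv0 : 0 < v := by positivity
  have hvn : 1 ≤ v * n := by
    rw [hv, add_mul, one_div_mul_cancel hn'.ne']
    nlinarith
  have h1 : 0 < c * (v / n) := by positivity
  have h2 : v ^ i / ρ ^ (i + j) ≤ v ^ i / (c * (v / n)) ^ (i + j) := by gcongr
  refine h2.trans ?_
  have h3 : v ^ i / (c * (v / n)) ^ (i + j) = (1 / c) ^ (i + j) * n ^ (i + j) * (1 / v) ^ j := by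
    simp only [pow_add, mul_pow, div_pow, one_pow]
    field_simp
  have h4 : (1 / v) ^ j ≤ (n : ℝ) ^ j := by
    apply pow_le_pow_left₀ (by positivity)
    rw [div_le_iff₀ hv0]
    linarith
  rw [h3, mul_assoc]
  have h5 : (n : ℝ) ^ (i + 2 * j) = n ^ (i + j) * n ^ j := by ring
  rw [h5]
  gcongr

/-- Pointwise bound of the weighted derivative by a value of the polynomial at a nearby point of
the complex plane. -/
lemma exists_weighted_derivative_le {μ : ℝ} (hμ1 : μ < 1) {n : ℕ} (hn : 0 < n)
    (Q : Polynomial ℂ) (i j : ℕ) {θ : ℝ}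
    (hθ0 : 0 ≤ θ) (hθ1 : θ ≤ Real.pi) (hθ : Real.sin (θ / 2) ^ 2 ≤ μ) :
    ∃ w : ℂ, w ≠ 0 ∧ ‖w‖ ≤ 1 ∧ 1 / 2 ≤ ‖w‖ ^ n ∧ (1 - μ) / 2 * Real.sin θ ≤ ‖w ^ 2 - 1‖ ∧
      (‖w - circleMap 0 1 θ‖ ≤ 1 / (4 * n) ∨ ‖w - (circleMap 0 1 θ)⁻¹‖ ≤ 1 / (4 * n)) ∧
      (Real.sin (θ / 2) + 1 / n) ^ i *
        ‖(Polynomial.derivative^[i + j] Q).eval ((Real.sin (θ / 2) ^ 2 : ℝ) : ℂ)‖ ≤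
      (i + j).factorial * (256 / (1 - μ)) ^ (i + j) * (n : ℝ) ^ (i + 2 * j) *
        ‖Q.eval (joukowski w)‖ := by
  have hn' : (0 : ℝ) < n := by exact_mod_cast hn
  obtain ⟨ρ, hρ, h⟩ := exists_radius_lift hμ1 hn hθ0 hθ1 hθ
  have hu : 0 ≤ Real.sin (θ / 2) :=
    Real.sin_nonneg_of_nonneg_of_le_pi (by linarith) (by linarith)
  have hc : 0 < (1 - μ) / 256 := by linarith
  have hρ0 : 0 < ρ := lt_of_lt_of_le (by positivity) hρ
  obtain ⟨z, hz, hQ⟩ := exists_norm_eval_iterate_derivative_le Q (i + j) _ hρ0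
  obtain ⟨w, hw0, hw1, hwz, hwn, hws, hwc⟩ := h z hz
  refine ⟨w, hw0, hw1, hwn, hws, hwc, ?_⟩
  have hW := weight_mul_inv_radius_pow_le hc hn hu hρ i j
  rw [one_div_div] at hW
  rw [hwz]
  calc _ ≤ (Real.sin (θ / 2) + 1 / n) ^ i *
        ((i + j).factorial * ‖Q.eval z‖ / ρ ^ (i + j)) := by gcongr
    _ = (i + j).factorial * ‖Q.eval z‖ *
        ((Real.sin (θ / 2) + 1 / n) ^ i / ρ ^ (i + j)) := by ring
    _ ≤ (i + j).factorial * ‖Q.eval z‖ *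
        ((256 / (1 - μ)) ^ (i + j) * (n : ℝ) ^ (i + 2 * j)) := by gcongr
    _ = _ := by ring

/-- The sum of the local averages over the two points of the unit circle above `sin² (θ / 2)`. -/
def averageAbove (Q : Polynomial ℂ) (n : ℕ) (p θ : ℝ) : ℝ :=
  localAverage (pullbackWeight n Q p) n (circleMap 0 1 θ) +
    localAverage (pullbackWeight n Q p) n (circleMap 0 1 θ)⁻¹

lemma localAverage_pullbackWeight_nonneg (Q : Polynomial ℂ) (n : ℕ) (p : ℝ) (w : ℂ) :
    0 ≤ localAverage (pullbackWeight n Q p) n w :=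
  localAverage_nonneg (weightedNormRpow_nonneg _ _ _) n w

lemma averageAbove_nonneg (Q : Polynomial ℂ) (n : ℕ) (p θ : ℝ) : 0 ≤ averageAbove Q n p θ :=
  add_nonneg (localAverage_pullbackWeight_nonneg _ _ _ _)
    (localAverage_pullbackWeight_nonneg _ _ _ _)

lemma continuous_averageAbove (Q : Polynomial ℂ) (n : ℕ) {p : ℝ} (hp : 0 < p) :
    Continuous (averageAbove Q n p) := by
  have h := continuous_localAverage (continuous_weightedNormRpow (joukowskiPullback n Q)
    (Polynomial.X ^ 2 - 1) hp.le) n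
  refine (h.comp (continuous_circleMap 0 1)).add (h.comp ?_)
  exact (continuous_circleMap 0 1).inv₀ fun θ => circleMap_ne_center one_ne_zero

lemma integral_averageAbove_le {n : ℕ} (hn : 0 < n) {Q : Polynomial ℂ} (hQ : Q.natDegree ≤ n)
    {p : ℝ} (hp : 0 < p) :
    ∫ θ in (0 : ℝ)..2 * Real.pi, averageAbove Q n p θ ≤
      2 * (2 * Real.pi) * (3 ^ p * 3 * Real.circleAverage (pullbackWeight n Q p) 0 1) := by
  set A := localAverage (pullbackWeight n Q p) n with hA
  have hAc : Continuous A := continuous_localAverage (continuous_weightedNormRpow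
    (joukowskiPullback n Q) (Polynomial.X ^ 2 - 1) hp.le) n
  have h1 : ∫ θ in (0 : ℝ)..2 * Real.pi, averageAbove Q n p θ =
      (2 * Real.pi) * Real.circleAverage A 0 1 +
        (2 * Real.pi) * Real.circleAverage (fun w => A w⁻¹) 0 1 := by
    rw [Real.circleAverage_def, Real.circleAverage_def, smul_eq_mul, smul_eq_mul,
      mul_inv_cancel_left₀ Real.two_pi_pos.ne', mul_inv_cancel_left₀ Real.two_pi_pos.ne',
      ← intervalIntegral.integral_add]
    · rfl
    · exact (hAc.comp (continuous_circleMap 0 1)).intervalIntegrable _ _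
    · exact (hAc.comp ((continuous_circleMap 0 1).inv₀
        fun θ => circleMap_ne_center one_ne_zero)).intervalIntegrable _ _
  rw [h1, Real.circleAverage_zero_one_congr_inv]
  have := circleAverage_localAverage_le hn hQ hp
  nlinarith [Real.pi_pos]

lemma rpow_weighted_derivative_mul_sin_le {μ : ℝ} (hμ1 : μ < 1) {n : ℕ} (hn : 0 < n)
    {Q : Polynomial ℂ} (hQ : Q.natDegree ≤ n) {p : ℝ} (hp : 0 < p) (i j : ℕ) {θ : ℝ}
    (hθ0 : 0 ≤ θ) (hθ1 : θ ≤ Real.pi) (hθ : Real.sin (θ / 2) ^ 2 ≤ μ) :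
    ((Real.sin (θ / 2) + 1 / n) ^ i *
        ‖(Polynomial.derivative^[i + j] Q).eval ((Real.sin (θ / 2) ^ 2 : ℝ) : ℂ)‖) ^ p *
      Real.sin θ ≤
    ((i + j).factorial * (256 / (1 - μ)) ^ (i + j) * (n : ℝ) ^ (i + 2 * j)) ^ p *
      (2 ^ p * 3 * (2 / (1 - μ))) * averageAbove Q n p θ := by
  obtain ⟨w, hw0, hw1, hwn, hws, hwc, hD⟩ :=
    exists_weighted_derivative_le hμ1 hn Q i j hθ0 hθ1 hθ
  have hμ : 0 < 1 - μ := by linarith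
  have hs : 0 ≤ Real.sin θ := Real.sin_nonneg_of_nonneg_of_le_pi hθ0 hθ1
  have hu : 0 ≤ Real.sin (θ / 2) :=
    Real.sin_nonneg_of_nonneg_of_le_pi (by linarith) (by linarith)
  have hcirc : ‖circleMap 0 1 θ‖ = 1 := by simp
  have hF : pullbackWeight n Q p w ≤ 3 * averageAbove Q n p θ := by
    have h0 := localAverage_pullbackWeight_nonneg Q n p (circleMap 0 1 θ)
    have h1 := localAverage_pullbackWeight_nonneg Q n p (circleMap 0 1 θ)⁻¹
    unfold averageAbove
    rcases hwc with h | h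
    · have := weightedNormRpow_le_localAverage (joukowskiPullback n Q) (Polynomial.X ^ 2 - 1) hp
        hn hcirc h
      linarith
    · have := weightedNormRpow_le_localAverage (joukowskiPullback n Q) (Polynomial.X ^ 2 - 1) hp
        hn (by rw [norm_inv, hcirc, inv_one]) h
      linarith
  have hF' : (1 / 2) ^ p * (‖Q.eval (joukowski w)‖ ^ p * ((1 - μ) / 2 * Real.sin θ)) ≤
      pullbackWeight n Q p w := by
    rw [pullbackWeight_eq hQ p hw0, mul_assoc]
    gcongr
  have hone : (2 : ℝ) ^ p * (1 / 2) ^ p = 1 := by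
    rw [← Real.mul_rpow (by norm_num) (by norm_num)]
    norm_num
  have hval : ‖Q.eval (joukowski w)‖ ^ p * Real.sin θ ≤
      2 ^ p * 3 * (2 / (1 - μ)) * averageAbove Q n p θ := by
    calc ‖Q.eval (joukowski w)‖ ^ p * Real.sin θ
        = (2 ^ p * (1 / 2) ^ p) * (‖Q.eval (joukowski w)‖ ^ p * Real.sin θ) := by
          rw [hone, one_mul]
      _ = 2 ^ p * (2 / (1 - μ)) * ((1 / 2) ^ p *
          (‖Q.eval (joukowski w)‖ ^ p * ((1 - μ) / 2 * Real.sin θ))) := by field_simp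
      _ ≤ 2 ^ p * (2 / (1 - μ)) * (3 * averageAbove Q n p θ) := by
          exact mul_le_mul_of_nonneg_left (hF'.trans hF) (by positivity)
      _ = _ := by ring
  set B : ℝ := (i + j).factorial * (256 / (1 - μ)) ^ (i + j) * (n : ℝ) ^ (i + 2 * j) with hB
  have hB0 : 0 ≤ B := by positivity
  calc _ ≤ (B * ‖Q.eval (joukowski w)‖) ^ p * Real.sin θ := by gcongr
    _ = B ^ p * (‖Q.eval (joukowski w)‖ ^ p * Real.sin θ) := by
      rw [Real.mul_rpow hB0 (norm_nonneg _), mul_assoc]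
    _ ≤ B ^ p * (2 ^ p * 3 * (2 / (1 - μ)) * averageAbove Q n p θ) := by gcongr
    _ = _ := by ring

lemma integral_comp_sin_half_sq {H : ℝ → ℝ} (hH : Continuous H) (b : ℝ) :
    ∫ θ in (0 : ℝ)..b, H (Real.sin (θ / 2) ^ 2) * Real.sin θ =
      2 * ∫ t in (0 : ℝ)..Real.sin (b / 2) ^ 2, H t := by
  have h := intervalIntegral.integral_comp_mul_deriv (a := 0) (b := b)
    (f := fun θ => Real.sin (θ / 2) ^ 2) (f' := fun θ => Real.sin θ / 2) (g := H)
    (fun θ _ => by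
      have h1 : HasDerivAt (fun θ : ℝ => Real.sin (θ / 2)) (Real.cos (θ / 2) * (1 / 2)) θ :=
        ((hasDerivAt_id θ).div_const 2).sin
      have h2 := h1.pow 2
      have h3 : Real.sin θ = 2 * Real.sin (θ / 2) * Real.cos (θ / 2) := by
        rw [← Real.sin_two_mul]
        congr 1
        ring
      refine h2.congr_deriv ?_
      rw [h3]
      push_cast
      ring)
    (by fun_prop) hH
  simp only [zero_div, Real.sin_zero, ne_eq, OfNat.ofNat_ne_zero, not_false_eq_true, zero_pow,
    Function.comp_apply] at h
  rw [← h, ← intervalIntegral.integral_const_mul]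
  congr 1
  ext θ
  ring

lemma circleAverage_pullbackWeight_eq {n : ℕ} {Q : Polynomial ℂ} (hQ : Q.natDegree ≤ n)
    {p : ℝ} (hp : 0 < p) :
    2 * Real.pi * Real.circleAverage (pullbackWeight n Q p) 0 1 =
      8 * ∫ t in (0 : ℝ)..1, ‖Q.eval (t : ℂ)‖ ^ p := by
  set H : ℝ → ℝ := fun t => ‖Q.eval (t : ℂ)‖ ^ p with hH
  have hHc : Continuous H := by
    refine Continuous.rpow_const ?_ fun _ => Or.inr hp.le
    exact (Q.continuous.comp Complex.continuous_ofReal).norm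
  have hval : ∀ θ : ℝ, pullbackWeight n Q p (circleMap 0 1 θ) =
      2 * (H (Real.sin (θ / 2) ^ 2) * |Real.sin θ|) := by
    intro θ
    have h0 : circleMap 0 1 θ ≠ 0 := circleMap_ne_center one_ne_zero
    have h1 : ‖circleMap 0 1 θ‖ = 1 := by simp
    have h2 : (circleMap 0 1 θ) ^ 2 - 1 =
        circleMap 0 1 θ * (((2 * Real.sin θ : ℝ) : ℂ) * Complex.I) := by
      have h3 := Complex.sin_sq_add_cos_sq (θ : ℂ)
      simp only [circleMap, zero_add, Complex.ofReal_one, one_mul, Complex.exp_mul_I]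
      push_cast
      linear_combination h3 - Complex.sin θ ^ 2 * Complex.I_sq
    rw [pullbackWeight_eq hQ p h0, h1, one_pow, Real.one_rpow, one_mul, joukowski_circleMap, h2,
      norm_mul, h1, one_mul, norm_mul, Complex.norm_I, mul_one, Complex.norm_real,
      Real.norm_eq_abs, abs_mul, abs_two]
    ring
  have hc : Continuous fun θ : ℝ => 2 * (H (Real.sin (θ / 2) ^ 2) * |Real.sin θ|) := by
    fun_prop
  have hfirst : ∫ θ in (0 : ℝ)..Real.pi, 2 * (H (Real.sin (θ / 2) ^ 2) * |Real.sin θ|) =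
      4 * ∫ t in (0 : ℝ)..1, H t := by
    rw [intervalIntegral.integral_const_mul]
    have h1 : ∫ θ in (0 : ℝ)..Real.pi, H (Real.sin (θ / 2) ^ 2) * |Real.sin θ| =
        ∫ θ in (0 : ℝ)..Real.pi, H (Real.sin (θ / 2) ^ 2) * Real.sin θ := by
      refine intervalIntegral.integral_congr fun θ hθ => ?_
      rw [uIcc_of_le Real.pi_pos.le] at hθ
      rw [abs_of_nonneg (Real.sin_nonneg_of_mem_Icc hθ)]
    rw [h1, integral_comp_sin_half_sq hHc, Real.sin_pi_div_two, one_pow]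
    ring
  have hsecond : ∫ θ in Real.pi..2 * Real.pi, 2 * (H (Real.sin (θ / 2) ^ 2) * |Real.sin θ|) =
      ∫ θ in (0 : ℝ)..Real.pi, 2 * (H (Real.sin (θ / 2) ^ 2) * |Real.sin θ|) := by
    have h1 := intervalIntegral.integral_comp_sub_left (a := 0) (b := Real.pi)
      (fun θ => 2 * (H (Real.sin (θ / 2) ^ 2) * |Real.sin θ|)) (2 * Real.pi)
    rw [sub_zero, two_mul Real.pi, add_sub_cancel_right, ← two_mul] at h1
    rw [← h1]
    congr 1
    ext θ
    have h2 : Real.sin ((2 * Real.pi - θ) / 2) = Real.sin (θ / 2) := by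
      rw [sub_div, mul_div_cancel_left₀ _ two_ne_zero, Real.sin_pi_sub]
    rw [h2, Real.sin_two_pi_sub, abs_neg]
  rw [Real.circleAverage_def, smul_eq_mul, mul_inv_cancel_left₀ Real.two_pi_pos.ne']
  simp only [hval]
  rw [← intervalIntegral.integral_add_adjacent_intervals (b := Real.pi)
    (hc.intervalIntegrable _ _) (hc.intervalIntegrable _ _), hsecond, hfirst]
  ring

/-- Weighted Bernstein inequality on `[0, 1]` in `L^p`, `0 < p < ∞`, the norm on the left being
over `[0, μ]` with `μ < 1`. -/
lemma integral_rpow_weighted_derivative_le {μ : ℝ} (hμ0 : 0 ≤ μ) (hμ1 : μ < 1) {n : ℕ}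
    (hn : 0 < n) {Q : Polynomial ℂ} (hQ : Q.natDegree ≤ n) {p : ℝ} (hp : 0 < p) (i j : ℕ) :
    ∫ t in (0 : ℝ)..μ, ((Real.sqrt t + 1 / n) ^ i *
        ‖(Polynomial.derivative^[i + j] Q).eval (t : ℂ)‖) ^ p ≤
    ((i + j).factorial * (256 / (1 - μ)) ^ (i + j) * (n : ℝ) ^ (i + 2 * j)) ^ p *
      (2 ^ p * 3 * (2 / (1 - μ)) * (3 ^ p * 24)) *
        ∫ t in (0 : ℝ)..1, ‖Q.eval (t : ℂ)‖ ^ p := by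
  set G : ℝ → ℝ := fun t => ((Real.sqrt t + 1 / n) ^ i *
        ‖(Polynomial.derivative^[i + j] Q).eval (t : ℂ)‖) ^ p with hG
  have hGc : Continuous G := by
    refine Continuous.rpow_const ?_ fun _ => Or.inr hp.le
    refine ((Real.continuous_sqrt.add continuous_const).pow i).mul ?_
    exact ((Polynomial.derivative^[i + j] Q).continuous.comp Complex.continuous_ofReal).norm
  set b : ℝ := 2 * Real.arcsin (Real.sqrt μ) with hb
  have hb0 : 0 ≤ b := by
    have := Real.arcsin_nonneg.2 (Real.sqrt_nonneg μ)
    positivity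
  have hbpi : b ≤ Real.pi := by
    have := Real.arcsin_le_pi_div_two (Real.sqrt μ)
    linarith
  have hsqrt1 : Real.sqrt μ ≤ 1 := Real.sqrt_le_one.2 hμ1.le
  have hsinb : Real.sin (b / 2) = Real.sqrt μ := by
    rw [hb, mul_div_cancel_left₀ _ two_ne_zero]
    exact Real.sin_arcsin (by linarith [Real.sqrt_nonneg μ]) hsqrt1
  have hsub := integral_comp_sin_half_sq hGc b
  rw [hsinb, Real.sq_sqrt hμ0] at hsub
  set K : ℝ := ((i + j).factorial * (256 / (1 - μ)) ^ (i + j) * (n : ℝ) ^ (i + 2 * j)) ^ p *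
      (2 ^ p * 3 * (2 / (1 - μ))) with hK
  have hμ : 0 < 1 - μ := by linarith
  have hK0 : 0 ≤ K := by positivity
  have hAc := continuous_averageAbove Q n hp
  have hle : ∫ θ in (0 : ℝ)..b, G (Real.sin (θ / 2) ^ 2) * Real.sin θ ≤
      ∫ θ in (0 : ℝ)..b, K * averageAbove Q n p θ := by
    refine intervalIntegral.integral_mono_on hb0
      (Continuous.intervalIntegrable (by fun_prop) _ _)
      (Continuous.intervalIntegrable (by fun_prop) _ _) fun θ hθ => ?_
    have hu : 0 ≤ Real.sin (θ / 2) :=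
      Real.sin_nonneg_of_nonneg_of_le_pi (by linarith [hθ.1]) (by linarith [hθ.1, hθ.2])
    have hθμ : Real.sin (θ / 2) ^ 2 ≤ μ := by
      rw [← Real.sq_sqrt hμ0, ← hsinb]
      refine pow_le_pow_left₀ hu ?_ 2
      exact Real.sin_le_sin_of_le_of_le_pi_div_two (by linarith [hθ.1, Real.pi_pos])
        (by linarith) (by linarith [hθ.2])
    have := rpow_weighted_derivative_mul_sin_le hμ1 hn hQ hp i j hθ.1 (hθ.2.trans hbpi) hθμ
    simp only [hG]
    rw [Real.sqrt_sq hu]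
    exact this
  have hmono : ∫ θ in (0 : ℝ)..b, averageAbove Q n p θ ≤
      ∫ θ in (0 : ℝ)..2 * Real.pi, averageAbove Q n p θ :=
    intervalIntegral.integral_mono_interval le_rfl hb0 (by linarith [Real.pi_pos])
      (Filter.Eventually.of_forall fun θ => averageAbove_nonneg Q n p θ)
      (hAc.intervalIntegrable _ _)
  have hA := integral_averageAbove_le hn hQ hp
  have hI := circleAverage_pullbackWeight_eq hQ hp
  rw [intervalIntegral.integral_const_mul] at hle
  have h2 : ∫ θ in (0 : ℝ)..b, averageAbove Q n p θ ≤
      3 ^ p * 48 * ∫ t in (0 : ℝ)..1, ‖Q.eval (t : ℂ)‖ ^ p := by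
    refine (hmono.trans hA).trans (le_of_eq ?_)
    linear_combination 2 * (3 ^ p * 3) * hI
  have h3 := mul_le_mul_of_nonneg_left h2 hK0
  change ∫ t in (0 : ℝ)..μ, G t ≤ _
  have h4 : 2 * ∫ t in (0 : ℝ)..μ, G t ≤
      K * (3 ^ p * 48 * ∫ t in (0 : ℝ)..1, ‖Q.eval (t : ℂ)‖ ^ p) := by
    rw [← hsub]
    exact hle.trans h3
  rw [hK] at h4
  linarith

lemma norm_eval_joukowski_le {n : ℕ} {Q : Polynomial ℂ} (hQ : Q.natDegree ≤ n) {S : ℝ}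
    (hS : ∀ t ∈ Icc (0 : ℝ) 1, ‖Q.eval (t : ℂ)‖ ≤ S) {w : ℂ} (hw0 : w ≠ 0) (hw1 : ‖w‖ ≤ 1) :
    ‖w‖ ^ n * ‖Q.eval (joukowski w)‖ ≤ S := by
  rw [← norm_pow, ← norm_mul, ← eval_joukowskiPullback hQ hw0]
  refine Complex.norm_le_of_forall_mem_frontier_norm_le (U := Metric.ball 0 1)
    (f := fun w => (joukowskiPullback n Q).eval w) Metric.isBounded_ball
    (joukowskiPullback n Q).differentiable.diffContOnCl (fun v hv => ?_) ?_
  · rw [frontier_ball _ one_ne_zero, mem_sphere_zero_iff_norm] at hv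
    have hv0 : v ≠ 0 := norm_pos_iff.1 (by rw [hv]; exact one_pos)
    obtain ⟨θ, rfl⟩ : ∃ θ, circleMap 0 1 θ = v := by
      have : v ∈ range (circleMap 0 1) := by
        rw [range_circleMap]
        simpa using hv
      exact this
    rw [eval_joukowskiPullback hQ hv0, norm_mul, norm_pow, hv, one_pow, one_mul,
      joukowski_circleMap]
    exact hS _ ⟨sq_nonneg _, Real.sin_sq_le_one _⟩
  · rw [closure_ball _ one_ne_zero]
    simpa using hw1

/-- Weighted Bernstein inequality on `[0, 1]` in the uniform norm. -/
lemma weighted_derivative_le_of_forall_norm_le {μ : ℝ} (hμ1 : μ < 1) {n : ℕ}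
    (hn : 0 < n) {Q : Polynomial ℂ} (hQ : Q.natDegree ≤ n) (i j : ℕ) {S : ℝ}
    (hS : ∀ t ∈ Icc (0 : ℝ) 1, ‖Q.eval (t : ℂ)‖ ≤ S) {t : ℝ} (ht : t ∈ Icc 0 μ) :
    (Real.sqrt t + 1 / n) ^ i * ‖(Polynomial.derivative^[i + j] Q).eval (t : ℂ)‖ ≤
    (i + j).factorial * (256 / (1 - μ)) ^ (i + j) * (n : ℝ) ^ (i + 2 * j) * (2 * S) := by
  set θ : ℝ := 2 * Real.arcsin (Real.sqrt t) with hθ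
  have hθ0 : 0 ≤ θ := by
    have := Real.arcsin_nonneg.2 (Real.sqrt_nonneg t)
    positivity
  have hθpi : θ ≤ Real.pi := by
    have := Real.arcsin_le_pi_div_two (Real.sqrt t)
    linarith
  have hsqrt1 : Real.sqrt t ≤ 1 := Real.sqrt_le_one.2 (ht.2.trans hμ1.le)
  have hsin : Real.sin (θ / 2) = Real.sqrt t := by
    rw [hθ, mul_div_cancel_left₀ _ two_ne_zero]
    exact Real.sin_arcsin (by linarith [Real.sqrt_nonneg t]) hsqrt1
  have hsq : Real.sin (θ / 2) ^ 2 = t := by rw [hsin, Real.sq_sqrt ht.1]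
  obtain ⟨w, hw0, hw1, hwn, -, -, hD⟩ :=
    exists_weighted_derivative_le hμ1 hn Q i j hθ0 hθpi (hsq.trans_le ht.2)
  rw [hsq, hsin] at hD
  refine hD.trans ?_
  have hμ : 0 < 1 - μ := by linarith
  have h1 := norm_eval_joukowski_le hQ hS hw0 hw1
  have h2 : ‖Q.eval (joukowski w)‖ ≤ 2 * S := by
    nlinarith [norm_nonneg (Q.eval (joukowski w))]
  gcongr

/-- The complexification of `t ↦ q (γ - B t)`. -/
def rescaledPoly (γ B : ℝ) (q : Polynomial ℝ) : Polynomial ℂ :=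
  (q.comp (Polynomial.C γ - Polynomial.C B * Polynomial.X)).map Complex.ofRealHom

lemma natDegree_rescaledPoly_le (γ B : ℝ) (q : Polynomial ℝ) :
    (rescaledPoly γ B q).natDegree ≤ q.natDegree := by
  refine Polynomial.natDegree_map_le.trans (Polynomial.natDegree_comp_le.trans ?_)
  refine (Nat.mul_le_mul_left _ (?_ : _ ≤ 1)).trans (mul_one _).le
  compute_degree

lemma eval_rescaledPoly (γ B : ℝ) (q : Polynomial ℝ) (t : ℝ) :
    (rescaledPoly γ B q).eval (t : ℂ) = (q.eval (γ - B * t) : ℝ) := by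
  rw [rescaledPoly, ← Complex.ofRealHom_eq_coe t, Polynomial.eval_map_apply]
  simp [Polynomial.eval_comp]

lemma iterate_derivative_rescaledPoly (γ B : ℝ) (q : Polynomial ℝ) (k : ℕ) :
    Polynomial.derivative^[k] (rescaledPoly γ B q) =
      Polynomial.C (((-B) ^ k : ℝ) : ℂ) * rescaledPoly γ B (Polynomial.derivative^[k] q) := by
  induction k with
  | zero => simp
  | succ k ih =>
    rw [Function.iterate_succ_apply', Function.iterate_succ_apply', ih]
    have h : Polynomial.derivative (rescaledPoly γ B (Polynomial.derivative^[k] q)) =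
        Polynomial.C ((-B : ℝ) : ℂ) *
          rescaledPoly γ B (Polynomial.derivative (Polynomial.derivative^[k] q)) := by
      simp [rescaledPoly, Polynomial.derivative_map, Polynomial.derivative_comp]
    rw [Polynomial.derivative_C_mul, h, ← mul_assoc, ← Polynomial.C_mul]
    congr 2
    push_cast
    ring

lemma norm_eval_iterate_derivative_rescaledPoly {γ B : ℝ} (hB : 0 < B) (q : Polynomial ℝ)
    (k : ℕ) (t : ℝ) :
    ‖(Polynomial.derivative^[k] (rescaledPoly γ B q)).eval (t : ℂ)‖ =
      B ^ k * |(Polynomial.derivative^[k] q).eval (γ - B * t)| := by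
  rw [iterate_derivative_rescaledPoly, Polynomial.eval_mul, Polynomial.eval_C, eval_rescaledPoly,
    norm_mul, Complex.norm_real, Complex.norm_real, Real.norm_eq_abs, Real.norm_eq_abs, abs_pow,
    abs_neg, abs_of_pos hB]

lemma weighted_derivative_rescaledPoly_le {γ B : ℝ} (hB : 0 < B) {n : ℕ} (hn : 0 < n)
    (q : Polynomial ℝ) (i j : ℕ) (t : ℝ) :
    (Real.sqrt (B * t) + 1 / n) ^ i *
        |(Polynomial.derivative^[i + j] q).eval (γ - B * t)| ≤
      (1 + Real.sqrt B) ^ i / B ^ (i + j) * ((Real.sqrt t + 1 / n) ^ i *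
        ‖(Polynomial.derivative^[i + j] (rescaledPoly γ B q)).eval (t : ℂ)‖) := by
  have hn' : (0 : ℝ) < n := by exact_mod_cast hn
  have h1 : Real.sqrt (B * t) + 1 / n ≤ (1 + Real.sqrt B) * (Real.sqrt t + 1 / n) := by
    rw [Real.sqrt_mul hB.le]
    have h2 : 0 ≤ Real.sqrt B * (1 / n) := by positivity
    nlinarith [Real.sqrt_nonneg t]
  rw [norm_eval_iterate_derivative_rescaledPoly hB]
  calc _ ≤ ((1 + Real.sqrt B) * (Real.sqrt t + 1 / n)) ^ i *
        |(Polynomial.derivative^[i + j] q).eval (γ - B * t)| := by gcongr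
    _ = _ := by
      rw [mul_pow]
      field_simp

/-- The constant of the uniform norm inequality on an interval of length `B`. -/
def bernsteinConst (μ B : ℝ) (i j : ℕ) : ℝ :=
  (1 + Real.sqrt B) ^ i / B ^ (i + j) * ((i + j).factorial * (256 / (1 - μ)) ^ (i + j))

lemma bernsteinConst_pos {μ B : ℝ} (hμ : μ < 1) (hB : 0 < B) (i j : ℕ) :
    0 < bernsteinConst μ B i j := by
  have : 0 < 1 - μ := by linarith
  unfold bernsteinConst
  positivity

lemma weighted_derivative_le_of_forall_abs_le {μ B : ℝ} (hμ1 : μ < 1) (hB : 0 < B)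
    {n : ℕ} (hn : 0 < n) {q : Polynomial ℝ} (hq : q.natDegree ≤ n) (i j : ℕ) {γ S : ℝ}
    (hS : ∀ y ∈ Icc (γ - B) γ, |q.eval y| ≤ S) {y : ℝ} (hy : y ∈ Icc (γ - μ * B) γ) :
    (Real.sqrt (γ - y) + 1 / n) ^ i * |(Polynomial.derivative^[i + j] q).eval y| ≤
      2 * bernsteinConst μ B i j * (n : ℝ) ^ (i + 2 * j) * S := by
  obtain ⟨t, rfl⟩ : ∃ t, y = γ - B * t := ⟨(γ - y) / B, by field_simp; ring⟩
  have ht0 : 0 ≤ t := nonneg_of_mul_nonneg_right (by linarith [hy.2]) hB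
  have htμ : t ≤ μ := le_of_mul_le_mul_left (by linarith [hy.1]) hB
  rw [sub_sub_cancel]
  have h := weighted_derivative_le_of_forall_norm_le hμ1 hn
    ((natDegree_rescaledPoly_le γ B q).trans hq) i j (S := S) (fun s hs => by
      rw [eval_rescaledPoly, Complex.norm_real]
      exact hS _ ⟨by nlinarith [hs.2], by nlinarith [hs.1]⟩) ⟨ht0, htμ⟩
  refine (weighted_derivative_rescaledPoly_le hB hn q i j t).trans ?_
  have hB' : 0 ≤ (1 + Real.sqrt B) ^ i / B ^ (i + j) := by positivity
  refine (mul_le_mul_of_nonneg_left h hB').trans (le_of_eq ?_)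
  unfold bernsteinConst
  ring

/-- The constant of the `L^p` inequality on an interval. -/
def bernsteinConstLp (p μ B : ℝ) (i j : ℕ) : ℝ :=
  bernsteinConst μ B i j * (2 ^ p * 3 * (2 / (1 - μ)) * (3 ^ p * 24)) ^ (1 / p)

lemma bernsteinConstLp_pos (p : ℝ) {μ B : ℝ} (hμ : μ < 1) (hB : 0 < B) (i j : ℕ) :
    0 < bernsteinConstLp p μ B i j := by
  have : 0 < 1 - μ := by linarith
  have := bernsteinConst_pos hμ hB i j
  unfold bernsteinConstLp
  positivity

lemma integral_comp_interval {B : ℝ} (hB : 0 < B) (γ ν : ℝ) (H : ℝ → ℝ) :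
    ∫ y in (γ - ν * B)..γ, H y = B * ∫ t in (0 : ℝ)..ν, H (γ - B * t) := by
  rw [intervalIntegral.integral_comp_sub_mul H hB.ne', smul_eq_mul, mul_inv_cancel_left₀ hB.ne',
    mul_zero, sub_zero, mul_comm ν B]

lemma integral_rpow_weighted_derivative_interval_le {μ B : ℝ} (hμ0 : 0 ≤ μ) (hμ1 : μ < 1)
    (hB : 0 < B) {n : ℕ} (hn : 0 < n) {q : Polynomial ℝ} (hq : q.natDegree ≤ n)
    {p : ℝ} (hp : 0 < p) (i j : ℕ) (γ : ℝ) :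
    ∫ y in (γ - μ * B)..γ, ((Real.sqrt (γ - y) + 1 / n) ^ i *
        |(Polynomial.derivative^[i + j] q).eval y|) ^ p ≤
      (bernsteinConstLp p μ B i j * (n : ℝ) ^ (i + 2 * j)) ^ p *
        ∫ y in (γ - B)..γ, |q.eval y| ^ p := by
  have hμ : 0 < 1 - μ := by linarith
  have hmain := integral_rpow_weighted_derivative_le hμ0 hμ1 hn
    ((natDegree_rescaledPoly_le γ B q).trans hq) hp i j
  set E : ℝ := (1 + Real.sqrt B) ^ i / B ^ (i + j) with hE
  have hE0 : 0 ≤ E := by positivity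
  have hleft : ∫ y in (γ - μ * B)..γ, ((Real.sqrt (γ - y) + 1 / n) ^ i *
        |(Polynomial.derivative^[i + j] q).eval y|) ^ p ≤
      B * (E ^ p * ∫ t in (0 : ℝ)..μ, ((Real.sqrt t + 1 / n) ^ i *
        ‖(Polynomial.derivative^[i + j] (rescaledPoly γ B q)).eval (t : ℂ)‖) ^ p) := by
    rw [integral_comp_interval hB γ μ]
    refine mul_le_mul_of_nonneg_left ?_ hB.le
    rw [← intervalIntegral.integral_const_mul]
    refine intervalIntegral.integral_mono_on hμ0 (Continuous.intervalIntegrable ?_ _ _)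
      (Continuous.intervalIntegrable ?_ _ _) fun t _ => ?_
    · refine Continuous.rpow_const ?_ fun _ => Or.inr hp.le
      fun_prop
    · refine continuous_const.mul (Continuous.rpow_const ?_ fun _ => Or.inr hp.le)
      refine ((Real.continuous_sqrt.add continuous_const).pow i).mul ?_
      exact ((Polynomial.derivative^[i + j] (rescaledPoly γ B q)).continuous.comp
        Complex.continuous_ofReal).norm
    · rw [← Real.mul_rpow hE0 (by positivity), sub_sub_cancel]
      exact Real.rpow_le_rpow (by positivity)
        (weighted_derivative_rescaledPoly_le hB hn q i j t) hp.le
  have hright : ∫ y in (γ - B)..γ, |q.eval y| ^ p =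
      B * ∫ t in (0 : ℝ)..1, ‖(rescaledPoly γ B q).eval (t : ℂ)‖ ^ p := by
    have := integral_comp_interval hB γ 1 (fun y => |q.eval y| ^ p)
    rw [one_mul] at this
    rw [this]
    simp only [eval_rescaledPoly, Complex.norm_real, Real.norm_eq_abs]
  refine hleft.trans ?_
  refine (mul_le_mul_of_nonneg_left (mul_le_mul_of_nonneg_left hmain (Real.rpow_nonneg hE0 p))
    hB.le).trans (le_of_eq ?_)
  rw [hright]
  have hroot : ((2 ^ p * 3 * (2 / (1 - μ)) * (3 ^ p * 24)) ^ (1 / p)) ^ p =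
      2 ^ p * 3 * (2 / (1 - μ)) * (3 ^ p * 24) := by
    rw [← Real.rpow_mul (by positivity), one_div_mul_cancel hp.ne', Real.rpow_one]
  have hb : bernsteinConstLp p μ B i j * (n : ℝ) ^ (i + 2 * j) =
      E * ((i + j).factorial * (256 / (1 - μ)) ^ (i + j) * (n : ℝ) ^ (i + 2 * j)) *
        (2 ^ p * 3 * (2 / (1 - μ)) * (3 ^ p * 24)) ^ (1 / p) := by
    rw [bernsteinConstLp, bernsteinConst]
    ring
  set D : ℝ := (i + j).factorial * (256 / (1 - μ)) ^ (i + j) * (n : ℝ) ^ (i + 2 * j)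
  rw [hb, Real.mul_rpow (x := E * D) (by positivity) (by positivity), hroot,
    Real.mul_rpow hE0 (by positivity)]
  ring

lemma setLIntegral_Ioc_enorm_rpow {H : ℝ → ℝ} (hH : Continuous H) {p : ℝ} (hp : 0 < p)
    {u v : ℝ} (huv : u ≤ v) :
    ∫⁻ y in Ioc u v, ‖H y‖ₑ ^ p = ENNReal.ofReal (∫ y in u..v, |H y| ^ p) := by
  have hc : Continuous fun y => |H y| ^ p := hH.abs.rpow_const fun _ => Or.inr hp.le
  rw [intervalIntegral.integral_of_le huv, ofReal_integral_eq_lintegral_ofReal]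
  · refine lintegral_congr fun y => ?_
    rw [Real.enorm_eq_ofReal_abs, ENNReal.ofReal_rpow_of_nonneg (abs_nonneg _) hp.le]
  · exact (intervalIntegrable_iff_integrableOn_Ioc_of_le huv).1 (hc.intervalIntegrable _ _)
  · exact Filter.Eventually.of_forall fun y => by positivity

lemma lintegral_weighted_derivative_interval_le {μ B : ℝ} (hμ0 : 0 ≤ μ) (hμ1 : μ < 1)
    (hB : 0 < B) {n : ℕ} (hn : 0 < n) {q : Polynomial ℝ} (hq : q.natDegree ≤ n)
    {p : ℝ} (hp : 0 < p) (i j : ℕ) (γ : ℝ) :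
    ∫⁻ y in Ioc (γ - μ * B) γ, ‖(Real.sqrt (γ - y) + 1 / n) ^ i *
        (Polynomial.derivative^[i + j] q).eval y‖ₑ ^ p ≤
      ENNReal.ofReal (bernsteinConstLp p μ B i j * (n : ℝ) ^ (i + 2 * j)) ^ p *
        ∫⁻ y in Ioc (γ - B) γ, ‖q.eval y‖ₑ ^ p := by
  have hb := bernsteinConstLp_pos p hμ1 hB i j
  have h := integral_rpow_weighted_derivative_interval_le hμ0 hμ1 hB hn hq hp i j γ
  rw [setLIntegral_Ioc_enorm_rpow (by fun_prop) hp (by nlinarith),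
    setLIntegral_Ioc_enorm_rpow q.continuous hp (by linarith),
    ENNReal.ofReal_rpow_of_nonneg (by positivity) hp.le, ← ENNReal.ofReal_mul (by positivity)]
  refine ENNReal.ofReal_le_ofReal (le_of_eq_of_le ?_ h)
  congr 1
  ext y
  rw [abs_mul, abs_of_nonneg (by positivity)]

/-- The points of vertical distance less than `B` below the graph of `g` over `(-a, a)`. -/
def stripBelow (a : ℝ) (g : ℝ → ℝ) (B : ℝ) : Set (ℝ × ℝ) :=
  {p | p.1 ∈ Ioo (-a) a ∧ g p.1 - B < p.2 ∧ p.2 ≤ g p.1}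

lemma measurableSet_stripBelow (a : ℝ) {g : ℝ → ℝ} (hg : Continuous g) (B : ℝ) :
    MeasurableSet (stripBelow a g B) := by
  have h : stripBelow a g B = {p | p.1 ∈ Ioo (-a) a} ∩
      ({p | g p.1 - B < p.2} ∩ {p | p.2 ≤ g p.1}) := rfl
  rw [h]
  refine (measurable_fst measurableSet_Ioo).inter (MeasurableSet.inter ?_ ?_)
  · exact measurableSet_lt (by fun_prop) (by fun_prop)
  · exact measurableSet_le (by fun_prop) (by fun_prop)

lemma stripBelow_indicator_eq (a : ℝ) (g : ℝ → ℝ) (B : ℝ) (h : ℝ × ℝ → ℝ≥0∞) (x y : ℝ) :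
    (stripBelow a g B).indicator h (x, y) = (Ioo (-a) a).indicator
      (fun x => (Ioc (g x - B) (g x)).indicator (fun y => h (x, y)) y) x := by
  by_cases hx : x ∈ Ioo (-a) a
  · rw [indicator_of_mem hx]
    by_cases hy : y ∈ Ioc (g x - B) (g x)
    · rw [indicator_of_mem hy, indicator_of_mem]
      exact ⟨hx, hy.1, hy.2⟩
    · rw [indicator_of_notMem hy, indicator_of_notMem]
      exact fun hc => hy ⟨hc.2.1, hc.2.2⟩
  · rw [indicator_of_notMem hx, indicator_of_notMem]
    exact fun hc => hx hc.1

lemma lintegral_lintegral_stripBelow_indicator (a : ℝ) (g : ℝ → ℝ) (B : ℝ)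
    (h : ℝ × ℝ → ℝ≥0∞) :
    ∫⁻ x, ∫⁻ y, (stripBelow a g B).indicator h (x, y) =
      ∫⁻ x in Ioo (-a) a, ∫⁻ y in Ioc (g x - B) (g x), h (x, y) := by
  rw [← lintegral_indicator measurableSet_Ioo]
  refine lintegral_congr fun x => ?_
  simp only [stripBelow_indicator_eq]
  by_cases hx : x ∈ Ioo (-a) a
  · simp only [indicator_of_mem hx]
    rw [lintegral_indicator measurableSet_Ioc]
  · simp only [indicator_of_notMem hx]
    simp

lemma setLIntegral_stripBelow_le (a : ℝ) {g : ℝ → ℝ} (hg : Continuous g) (B : ℝ)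
    (h : ℝ × ℝ → ℝ≥0∞) :
    ∫⁻ z in stripBelow a g B, h z ≤
      ∫⁻ x in Ioo (-a) a, ∫⁻ y in Ioc (g x - B) (g x), h (x, y) := by
  rw [← lintegral_indicator (measurableSet_stripBelow a hg B), Measure.volume_eq_prod,
    ← lintegral_lintegral_stripBelow_indicator]
  exact lintegral_prod_le _

lemma setLIntegral_stripBelow (a : ℝ) {g : ℝ → ℝ} (hg : Continuous g) (B : ℝ)
    {h : ℝ × ℝ → ℝ≥0∞} (hh : AEMeasurable h (volume.restrict (stripBelow a g B))) :
    ∫⁻ z in stripBelow a g B, h z =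
      ∫⁻ x in Ioo (-a) a, ∫⁻ y in Ioc (g x - B) (g x), h (x, y) := by
  have hm := measurableSet_stripBelow a hg B
  rw [← lintegral_indicator hm, Measure.volume_eq_prod,
    ← lintegral_lintegral_stripBelow_indicator]
  refine lintegral_prod _ ?_
  rw [← Measure.volume_eq_prod]
  exact (aemeasurable_indicator_iff hm).2 hh

/-- `f` is a polynomial of degree at most `n` on each vertical line meeting `[-a, a] × ℝ`. -/
def IsVerticalPoly (a : ℝ) (n : ℕ) (f : ℝ × ℝ → ℝ) : Prop :=
  ∀ x ∈ Icc (-a) a, ∃ q : Polynomial ℝ, q.natDegree ≤ n ∧ ∀ y : ℝ, f (x, y) = q.eval y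

lemma IsVerticalPoly.eq_sum_basis {a : ℝ} {n : ℕ} {f : ℝ × ℝ → ℝ} (hf : IsVerticalPoly a n f)
    {s : ℕ → ℝ} (hs : Function.Injective s) {x : ℝ} (hx : x ∈ Icc (-a) a) (γ y : ℝ) :
    f (x, y) = ∑ m ∈ Finset.range (n + 1),
      f (x, γ - s m) * (Lagrange.basis (Finset.range (n + 1)) s m).eval (γ - y) := by
  obtain ⟨q, hq, hfq⟩ := hf x hx
  set r : Polynomial ℝ := q.comp (Polynomial.C γ - Polynomial.X) with hr
  have hreval : ∀ t, r.eval t = f (x, γ - t) := by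
    intro t
    rw [hfq, hr, Polynomial.eval_comp]
    simp
  have hrdeg : r.natDegree ≤ n := by
    refine Polynomial.natDegree_comp_le.trans (le_trans ?_ hq)
    refine (Nat.mul_le_mul_left _ (?_ : _ ≤ 1)).trans (mul_one _).le
    compute_degree
  have hdeg : r.degree < (Finset.range (n + 1)).card := by
    rw [Finset.card_range]
    exact lt_of_le_of_lt (Polynomial.degree_le_of_natDegree_le hrdeg)
      (by exact_mod_cast Nat.lt_succ_self n)
  have h := Lagrange.eq_interpolate (s := Finset.range (n + 1)) (v := s) hs.injOn hdeg
  have h2 : f (x, y) = r.eval (γ - y) := by rw [hreval, sub_sub_cancel]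
  rw [h2, h, Lagrange.interpolate_apply, Polynomial.eval_finsetSum]
  simp [hreval]

lemma IsVerticalPoly.continuousOn {a : ℝ} {n : ℕ} {f : ℝ × ℝ → ℝ} (hf : IsVerticalPoly a n f)
    {g : ℝ → ℝ} (hg : Continuous g) {B B' : ℝ} (hB : 0 < B)
    (hfc : ContinuousOn f (stripBelow a g B)) : ContinuousOn f (stripBelow a g B') := by
  set s : ℕ → ℝ := fun m => B * (m / (n + 1 : ℝ)) with hs
  have hn : (0 : ℝ) < n + 1 := by positivity
  have hinj : Function.Injective s := by
    intro m k hmk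
    simp only [hs] at hmk
    have h1 := mul_left_cancel₀ hB.ne' hmk
    rw [div_left_inj' hn.ne'] at h1
    exact_mod_cast h1
  have hsum : ContinuousOn (fun z : ℝ × ℝ => ∑ m ∈ Finset.range (n + 1),
      f (z.1, g z.1 - s m) *
        (Lagrange.basis (Finset.range (n + 1)) s m).eval (g z.1 - z.2)) (stripBelow a g B') := by
    refine continuousOn_finsetSum _ fun m hm => ContinuousOn.mul ?_ ?_
    · refine hfc.comp (f := fun z : ℝ × ℝ => (z.1, g z.1 - s m))
        (Continuous.continuousOn (by fun_prop)) fun z hz => ⟨hz.1, ?_, ?_⟩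
      · have hmn : (m : ℝ) < n + 1 := by exact_mod_cast Finset.mem_range.1 hm
        have : (m : ℝ) / (n + 1) < 1 := (div_lt_one hn).2 hmn
        have : s m < B := by
          simp only [hs]
          nlinarith
        simpa using this
      · have : 0 ≤ s m := by positivity
        simpa using this
    · exact Continuous.continuousOn (by fun_prop)
  exact hsum.congr fun z hz => hf.eq_sum_basis hinj (Ioo_subset_Icc_self hz.1) (g z.1) z.2

lemma iterate_pd2_eq {f : ℝ × ℝ → ℝ} {x : ℝ} {q : Polynomial ℝ}
    (hq : ∀ y, f (x, y) = q.eval y) (k : ℕ) (y : ℝ) :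
    (pd2^[k] f) (x, y) = (Polynomial.derivative^[k] q).eval y := by
  induction k generalizing y with
  | zero => exact hq y
  | succ k ih =>
    rw [Function.iterate_succ_apply', Function.iterate_succ_apply', pd2]
    simp only [ih]
    exact Polynomial.deriv _

lemma eLpNorm_weighted_iterate_pd2_le {a B μ : ℝ} (hB : 0 < B) (hμ0 : 0 < μ) (hμ1 : μ < 1)
    {g : ℝ → ℝ} (hg : Continuous g) {p : ℝ≥0∞} (hp0 : p ≠ 0) (hpt : p ≠ ⊤) (i j : ℕ) {n : ℕ}
    (hn : 0 < n) {f : ℝ × ℝ → ℝ} (hfc : ContinuousOn f (stripBelow a g (μ * B)))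
    (hf : IsVerticalPoly a n f) :
    eLpNorm (fun q => phi2 g n q ^ i * (pd2^[i + j] f) q) p
        (volume.restrict (stripBelow a g (μ * B))) ≤
      ENNReal.ofReal (bernsteinConstLp p.toReal μ B i j * (n : ℝ) ^ (i + 2 * j)) *
        eLpNorm f p (volume.restrict (stripBelow a g B)) := by
  have hp : 0 < p.toReal := ENNReal.toReal_pos hp0 hpt
  rw [eLpNorm_eq_lintegral_rpow_enorm_toReal hp0 hpt,
    eLpNorm_eq_lintegral_rpow_enorm_toReal hp0 hpt]
  set D := ENNReal.ofReal (bernsteinConstLp p.toReal μ B i j * (n : ℝ) ^ (i + 2 * j)) with hD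
  have hfc' : ContinuousOn f (stripBelow a g B) := hf.continuousOn hg (by positivity) hfc
  have hmeas : AEMeasurable (fun z => ‖f z‖ₑ ^ p.toReal) (volume.restrict (stripBelow a g B)) :=
    (hfc'.aemeasurable (measurableSet_stripBelow a hg B)).enorm.pow_const _
  have key : ∫⁻ z in stripBelow a g (μ * B),
      ‖phi2 g n z ^ i * (pd2^[i + j] f) z‖ₑ ^ p.toReal ≤
      D ^ p.toReal * ∫⁻ z in stripBelow a g B, ‖f z‖ₑ ^ p.toReal := by
    rw [setLIntegral_stripBelow a hg B hmeas, ← lintegral_const_mul']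
    · refine (setLIntegral_stripBelow_le a hg _ _).trans ?_
      refine setLIntegral_mono' measurableSet_Ioo fun x hx => ?_
      obtain ⟨q, hq, hfq⟩ := hf x (Ioo_subset_Icc_self hx)
      simp only [iterate_pd2_eq hfq, hfq, phi2]
      exact lintegral_weighted_derivative_interval_le hμ0.le hμ1 hB hn hq hp i j (g x)
    · exact ENNReal.rpow_ne_top_of_nonneg hp.le ENNReal.ofReal_ne_top
  refine (ENNReal.rpow_le_rpow key (by positivity)).trans (le_of_eq ?_)
  rw [ENNReal.mul_rpow_of_nonneg _ _ (by positivity), ← ENNReal.rpow_mul, mul_one_div_cancel hp.ne',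
    ENNReal.rpow_one]

lemma abs_le_on_Icc_of_ae_le {h : ℝ → ℝ} (hh : Continuous h) {u v S : ℝ} (huv : u < v)
    (hS : ∀ᵐ y, y ∈ Ioc u v → |h y| ≤ S) : ∀ y ∈ Icc u v, |h y| ≤ S := by
  have hae : (fun y => max |h y| S) =ᵐ[volume.restrict (Icc u v)] fun _ => S := by
    rw [← Measure.restrict_congr_set Ioc_ae_eq_Icc]
    refine (ae_restrict_iff' measurableSet_Ioc).2 ?_
    filter_upwards [hS] with y hy hyI
    exact max_eq_right (hy hyI)
  have heq := Measure.eqOn_Icc_of_ae_eq volume huv.ne hae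
    (Continuous.continuousOn (by fun_prop)) continuousOn_const
  intro y hy
  exact max_eq_right_iff.1 (heq hy)

lemma eLpNorm_top_weighted_iterate_pd2_le {a B μ : ℝ} (hB : 0 < B) (hμ1 : μ < 1)
    {g : ℝ → ℝ} (hg : Continuous g) (i j : ℕ) {n : ℕ}
    (hn : 0 < n) {f : ℝ × ℝ → ℝ} (hf : IsVerticalPoly a n f) :
    eLpNorm (fun q => phi2 g n q ^ i * (pd2^[i + j] f) q) ⊤
        (volume.restrict (stripBelow a g (μ * B))) ≤
      ENNReal.ofReal (2 * bernsteinConst μ B i j * (n : ℝ) ^ (i + 2 * j)) *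
        eLpNorm f ⊤ (volume.restrict (stripBelow a g B)) := by
  rw [eLpNorm_exponent_top, eLpNorm_exponent_top]
  set S := eLpNormEssSup f (volume.restrict (stripBelow a g B)) with hS
  have hb := bernsteinConst_pos hμ1 hB i j
  have hn' : (0 : ℝ) < n := by exact_mod_cast hn
  rcases eq_or_ne S ⊤ with hSt | hSt
  · rw [hSt, ENNReal.mul_top]
    · exact le_top
    · rw [← pos_iff_ne_zero, ENNReal.ofReal_pos]
      positivity
  have h1 : ∀ᵐ z : ℝ × ℝ, z ∈ stripBelow a g B → ‖f z‖ₑ ≤ S :=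
    (ae_restrict_iff' (measurableSet_stripBelow a hg B)).1 (enorm_ae_le_eLpNormEssSup f _)
  rw [Measure.volume_eq_prod] at h1
  have h2 : ∀ᵐ x : ℝ, x ∈ Ioo (-a) a → ∀ y ∈ Icc (g x - B) (g x), |f (x, y)| ≤ S.toReal := by
    filter_upwards [Measure.ae_ae_of_ae_prod h1] with x hx hxa
    obtain ⟨q, -, hfq⟩ := hf x (Ioo_subset_Icc_self hxa)
    simp only [hfq] at hx ⊢
    refine abs_le_on_Icc_of_ae_le q.continuous (by linarith) ?_
    filter_upwards [hx] with y hy hyI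
    have h3 := ENNReal.toReal_mono hSt (hy ⟨hxa, hyI.1, hyI.2⟩)
    simpa using h3
  have h3 : ∀ᵐ z : ℝ × ℝ, z.1 ∈ Ioo (-a) a →
      ∀ y ∈ Icc (g z.1 - B) (g z.1), |f (z.1, y)| ≤ S.toReal :=
    Measure.quasiMeasurePreserving_fst.ae h2
  refine eLpNormEssSup_le_of_ae_enorm_bound ?_
  refine (ae_restrict_iff' (measurableSet_stripBelow a hg (μ * B))).2 ?_
  filter_upwards [h3] with z hz hzs
  obtain ⟨x, y⟩ := z
  obtain ⟨q, hq, hfq⟩ := hf x (Ioo_subset_Icc_self hzs.1)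
  have hz' := hz hzs.1
  simp only [hfq] at hz'
  have h4 := weighted_derivative_le_of_forall_abs_le hμ1 hB hn hq i j hz' (y := y)
    ⟨hzs.2.1.le, hzs.2.2⟩
  simp only [iterate_pd2_eq hfq, phi2]
  rw [Real.enorm_eq_ofReal_abs, abs_mul, abs_of_nonneg (by positivity), ← ENNReal.ofReal_toReal hSt,
    ← ENNReal.ofReal_mul (by positivity)]
  exact ENNReal.ofReal_le_ofReal h4

/-- **Lemma 4.4**: if `f ∈ C(G)` and `y ↦ f(x,y)` is a polynomial of degree at most `n` for each
fixed `x ∈ [−a,a]`, then `‖φ_n^i ∂₂^{i+j} f‖_{L^p(G)} ≤ c n^{i+2j} ‖f‖_{L^p(G(λ))}`. -/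
theorem univariate_bernstein_vertical (a L : ℝ) (ha : 0 < a) (hL : 1 ≤ L)
    (g : ℝ → ℝ) (hg : ContDiff ℝ 2 g)
    (hgmin₁ : ∀ x ∈ Icc (-(2 * a)) (2 * a), 4 * L * a ≤ g x)
    (hgmin₂ : ∃ x ∈ Icc (-(2 * a)) (2 * a), g x = 4 * L * a)
    (p : ℝ≥0∞) (hp : 0 < p) (lam : ℝ) (hlam1 : 1 < lam) (hlam2 : lam < 2) (i j : ℕ) :
    ∃ c : ℝ, 0 < c ∧ ∀ (n : ℕ), 0 < n → ∀ f : ℝ × ℝ → ℝ,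
      ContinuousOn f (Gset a L g 1) →
      (∀ x ∈ Icc (-a) a, ∃ q : Polynomial ℝ, q.natDegree ≤ n ∧ ∀ y : ℝ, f (x, y) = q.eval y) →
      eLpNorm (fun q => phi2 g n q ^ i * (pd2^[i + j] f) q) p (volume.restrict (Gset a L g 1))
        ≤ ENNReal.ofReal (c * (n : ℝ) ^ (i + 2 * j)) *
            eLpNorm f p (volume.restrict (Gset a L g lam)) := by
  have hlam0 : 0 < lam := by linarith
  have hL0 : 0 < L := by linarith
  have hB : 0 < lam * L * a := by positivity
  have hμ1 : 1 / lam < 1 := (div_lt_one hlam0).2 hlam1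
  have hμB : 1 / lam * (lam * L * a) = 1 * L * a := by field_simp
  have hG : Gset a L g 1 = stripBelow a g (1 / lam * (lam * L * a)) := by
    rw [hμB, Gset, one_mul a]
    rfl
  have hsub : stripBelow a g (lam * L * a) ⊆ Gset a L g lam := by
    rintro z ⟨⟨h1, h2⟩, h3⟩
    exact ⟨⟨by nlinarith, by nlinarith⟩, h3⟩
  rw [hG]
  rcases eq_or_ne p ⊤ with rfl | hpt
  · refine ⟨2 * bernsteinConst (1 / lam) (lam * L * a) i j,
      mul_pos two_pos (bernsteinConst_pos hμ1 hB i j), fun n hn f _ hf => ?_⟩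
    refine (eLpNorm_top_weighted_iterate_pd2_le hB hμ1 hg.continuous i j hn hf).trans ?_
    gcongr
  · refine ⟨bernsteinConstLp p.toReal (1 / lam) (lam * L * a) i j,
      bernsteinConstLp_pos _ hμ1 hB i j, fun n hn f hfc hf => ?_⟩
    refine (eLpNorm_weighted_iterate_pd2_le hB (by positivity) hμ1 hg.continuous hp.ne' hpt i j hn
      hfc hf).trans ?_
    gcongr
end
end

section
/- Let n, r ∈ ℕ and let ξ_1, …, ξ_r be arbitrary vectors in ℝ^n. Then, as operators on C^r functions on ℝ^n, ∂_{ξ_1} ∂_{ξ_2} ⋯ ∂_{ξ_r} = Σ_{S ⊆ {1,2,…,r}} (−1)^{#S} ∂_{ξ_S}^r, where the sum is over all subsets S of {1,…,r}, #S is the cardinality of S, and ξ_S := −Σ_{j∈S} j^{−1} ξ_j (with ξ_∅ = 0). That is, for every f ∈ C^r(ℝ^n) and every x ∈ ℝ^n, (∂_{ξ_1} ⋯ ∂_{ξ_r} f)(x) = Σ_{S ⊆ {1,…,r}} (−1)^{#S} (∂_{ξ_S}^r f)(x). -/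
noncomputable section

/-- The directional derivative `∂_v f = (v·∇)f` on `ℝ^n`. -/
def dirDeriv {n : ℕ} (v : EuclideanSpace ℝ (Fin n)) (f : EuclideanSpace ℝ (Fin n) → ℝ) :
    EuclideanSpace ℝ (Fin n) → ℝ := fun x => fderiv ℝ f x v

theorem contDiff_dirDeriv {n : ℕ} {f : EuclideanSpace ℝ (Fin n) → ℝ} {k : ℕ}
    (hf : ContDiff ℝ ((k + 1 : ℕ) : ℕ∞) f) (v : EuclideanSpace ℝ (Fin n)) :
    ContDiff ℝ (k : ℕ∞) (dirDeriv v f) :=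
  (hf.fderiv_right (m := (k : ℕ∞)) (by norm_cast)).clm_apply contDiff_const

theorem dirDeriv_comm {n : ℕ} {f : EuclideanSpace ℝ (Fin n) → ℝ} (hf : ContDiff ℝ 2 f)
    (v w : EuclideanSpace ℝ (Fin n)) : dirDeriv v (dirDeriv w f) = dirDeriv w (dirDeriv v f) := by
  funext x
  have hd : DifferentiableAt ℝ (fderiv ℝ f) x :=
    (hf.fderiv_right (m := 1) (by norm_num)).differentiable one_ne_zero x
  have hcomp (a b : EuclideanSpace ℝ (Fin n)) :
      dirDeriv a (dirDeriv b f) x = fderiv ℝ (fderiv ℝ f) x a b := by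
    change fderiv ℝ (fun y => fderiv ℝ f y b) x a = _
    rw [fderiv_clm_apply hd (differentiableAt_const b)]
    simp
  rw [hcomp, hcomp]
  exact hf.contDiffAt.isSymmSndFDerivAt (by simp) v w

theorem contDiff_foldr_dirDeriv {n : ℕ} {f : EuclideanSpace ℝ (Fin n) → ℝ}
    (l : List (EuclideanSpace ℝ (Fin n))) {k : ℕ}
    (hf : ContDiff ℝ ((k + l.length : ℕ) : ℕ∞) f) :
    ContDiff ℝ (k : ℕ∞) (((l.map dirDeriv).foldr (· ∘ ·) id) f) := by
  induction l generalizing k with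
  | nil => exact hf
  | cons v l ih =>
    refine contDiff_dirDeriv (ih (k := k + 1) ?_) v
    rwa [List.length_cons, ← add_assoc, add_right_comm] at hf

theorem List.Perm.foldr_dirDeriv_eq {n : ℕ} {f : EuclideanSpace ℝ (Fin n) → ℝ}
    {l₁ l₂ : List (EuclideanSpace ℝ (Fin n))} (h : l₁.Perm l₂)
    (hf : ContDiff ℝ (l₁.length : ℕ∞) f) :
    ((l₁.map dirDeriv).foldr (· ∘ ·) id) f = ((l₂.map dirDeriv).foldr (· ∘ ·) id) f := by
  induction h with
  | nil => rfl
  | cons v _ ih =>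
    exact congrArg (dirDeriv v) (ih (hf.of_le (by exact_mod_cast Nat.le_succ _)))
  | swap v w l =>
    refine dirDeriv_comm (contDiff_foldr_dirDeriv l (k := 2) ?_) w v
    rwa [List.length_cons, List.length_cons, add_assoc, add_comm] at hf
  | trans h₁ _ ih₁ ih₂ => exact (ih₁ hf).trans (ih₂ (h₁.length_eq ▸ hf))

theorem foldr_ofFn_dirDeriv_apply {n : ℕ} (r : ℕ) (ξ : Fin r → EuclideanSpace ℝ (Fin n))
    (f : EuclideanSpace ℝ (Fin n) → ℝ) (hf : ContDiff ℝ (r : ℕ∞) f)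
    (x : EuclideanSpace ℝ (Fin n)) :
    ((List.ofFn fun j : Fin r => dirDeriv (ξ j)).foldr (· ∘ ·) id) f x
      = iteratedFDeriv ℝ r f x ξ := by
  induction r generalizing x with
  | zero => simp
  | succ r ih =>
    have hg : ((List.ofFn fun j : Fin r => dirDeriv (ξ j.succ)).foldr (· ∘ ·) id) f
        = fun y => iteratedFDeriv ℝ r f y (fun j => ξ j.succ) :=
      funext fun y => ih _ (hf.of_le (by exact_mod_cast Nat.le_succ r)) y
    have hd : DifferentiableAt ℝ (iteratedFDeriv ℝ r f) x :=
      (hf.differentiable_iteratedFDeriv (by exact_mod_cast Nat.lt_succ_self r)) x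
    rw [List.ofFn_succ, List.foldr_cons, Function.comp_apply, hg, iteratedFDeriv_succ_apply_left,
      dirDeriv, fderiv_continuousMultilinear_apply_const_apply hd]
    rfl

theorem dirDeriv_iterate_apply {n : ℕ} (r : ℕ) (v : EuclideanSpace ℝ (Fin n))
    (f : EuclideanSpace ℝ (Fin n) → ℝ) (hf : ContDiff ℝ (r : ℕ∞) f)
    (x : EuclideanSpace ℝ (Fin n)) :
    (dirDeriv v)^[r] f x = iteratedFDeriv ℝ r f x fun _ => v := by
  rw [← foldr_ofFn_dirDeriv_apply r _ f hf, List.ofFn_const]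
  have h (k : ℕ) :
      (dirDeriv v)^[k] f = ((List.replicate k (dirDeriv v)).foldr (· ∘ ·) id) f := by
    induction k with
    | zero => rfl
    | succ k ih => rw [Function.iterate_succ_apply', ih, List.replicate_succ]; rfl
  rw [h]

/-- The iterated derivative of a function of class `C^r` is symmetric. -/
theorem ContDiff.iteratedFDeriv_comp_perm {n r : ℕ} {f : EuclideanSpace ℝ (Fin n) → ℝ}
    (hf : ContDiff ℝ (r : ℕ∞) f) (x : EuclideanSpace ℝ (Fin n))
    (v : Fin r → EuclideanSpace ℝ (Fin n)) (σ : Equiv.Perm (Fin r)) :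
    iteratedFDeriv ℝ r f x (v ∘ σ) = iteratedFDeriv ℝ r f x v := by
  have h := (σ.ofFn_comp_perm v).foldr_dirDeriv_eq (f := f) (by simpa using hf)
  rw [List.map_ofFn, List.map_ofFn] at h
  rw [← foldr_ofFn_dirDeriv_apply r _ f hf, ← foldr_ofFn_dirDeriv_apply r _ f hf]
  exact congrFun h x

theorem sum_neg_one_pow_card_mul_ite_subset {ι : Type*} [Fintype ι] [DecidableEq ι]
    (T : Finset ι) :
    ∑ S : Finset ι, (-1 : ℝ) ^ S.card * (if T ⊆ S then 1 else 0)
      = if T = Finset.univ then (-1) ^ Fintype.card ι else 0 := by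
  have h := Finset.prod_add (fun _ : ι => (-1 : ℝ)) (fun i => if i ∈ T then 0 else 1) Finset.univ
  have hS (S : Finset ι) : ∏ i ∈ Finset.univ \ S, (if i ∈ T then (0 : ℝ) else 1)
      = if T ⊆ S then 1 else 0 := by
    split_ifs with hTS
    · exact Finset.prod_eq_one fun i hi => if_neg fun hT => by simp_all [hTS hT]
    · obtain ⟨i, hiT, hiS⟩ := Finset.not_subset.mp hTS
      exact Finset.prod_eq_zero (i := i) (by simpa using hiS) (if_pos hiT)
  simp only [Finset.prod_const, hS, Finset.powerset_univ] at h
  rw [← h]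
  split_ifs with hT
  · simp [hT]
  · obtain ⟨i, hi⟩ : ∃ i, i ∉ T := by simpa [Finset.eq_univ_iff_forall] using hT
    exact Finset.prod_eq_zero (i := i) (Finset.mem_univ i) (by simp [hi])

/-- The polarization formula for symmetric multilinear forms. -/
theorem MultilinearMap.sum_neg_one_pow_card_mul_map_neg_sum {ι E : Type*} [Fintype ι]
    [DecidableEq ι] [AddCommGroup E] [Module ℝ E] (M : MultilinearMap ℝ (fun _ : ι => E) ℝ)
    (hM : ∀ (v : ι → E) (σ : Equiv.Perm ι), M (v ∘ σ) = M v) (v : ι → E) :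
    ∑ S : Finset ι, (-1 : ℝ) ^ S.card * M (fun _ => -∑ j ∈ S, v j)
      = (Fintype.card ι).factorial * M v := by
  have hexp (S : Finset ι) : M (fun _ => -∑ j ∈ S, v j) = (-1) ^ Fintype.card ι *
      ∑ t : ι → ι, (if Finset.univ.image t ⊆ S then 1 else 0) * M (v ∘ t) := by
    have h1 := M.map_smul_univ (fun _ => (-1 : ℝ)) (fun _ => ∑ j ∈ S, v j)
    simp only [neg_smul, one_smul, Finset.prod_const, Finset.card_univ, smul_eq_mul] at h1
    rw [h1, M.map_sum_finset (fun _ j => v j) (fun _ => S)]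
    simp only [ite_mul, one_mul, zero_mul, ← Finset.sum_filter]
    congr 2
    ext t
    simp [Fintype.mem_piFinset, Finset.image_subset_iff]
  have hsurj (t : ι → ι) : Finset.univ.image t = Finset.univ ↔ Function.Bijective t := by
    rw [← Finite.surjective_iff_bijective, Finset.eq_univ_iff_forall]
    simp [Function.Surjective]
  calc
    _ = (-1) ^ Fintype.card ι * ∑ t : ι → ι, (∑ S : Finset ι, (-1 : ℝ) ^ S.card *
          (if Finset.univ.image t ⊆ S then 1 else 0)) * M (v ∘ t) := by
      simp only [hexp, Finset.mul_sum, Finset.sum_mul]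
      rw [Finset.sum_comm]
      exact Finset.sum_congr rfl fun _ _ => Finset.sum_congr rfl fun _ _ => by ring
    _ = ∑ t : ι → ι with Function.Bijective t, M (v ∘ t) := by
      simp only [sum_neg_one_pow_card_mul_ite_subset, hsurj, ite_mul, zero_mul]
      rw [← Finset.sum_filter, ← Finset.mul_sum, ← mul_assoc, ← mul_pow]
      simp
    _ = ∑ _t : ι → ι with Function.Bijective _t, M v :=
      Finset.sum_congr rfl fun t ht =>
        hM v (Equiv.ofBijective t (Finset.mem_filter.mp ht).2)
    _ = _ := by
      rw [Finset.sum_const, nsmul_eq_mul, ← Fintype.card_perm, ← Fintype.card_subtype,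
        Fintype.card_congr (Equiv.ofBijective (fun σ : Equiv.Perm ι =>
          (⟨σ, σ.bijective⟩ : {t : ι → ι // Function.Bijective t}))
          ⟨fun σ τ h => DFunLike.coe_injective (congrArg Subtype.val h),
            fun t => ⟨Equiv.ofBijective t.1 t.2, rfl⟩⟩)]

/-- **Lemma 5.5** (Kemperman-type identity for mixed directional derivatives):
`∂_{ξ_1}∂_{ξ_2}⋯∂_{ξ_r} f(x) = Σ_{S ⊆ {1,…,r}} (−1)^{#S} ∂_{ξ_S}^r f(x)` where
`ξ_S = −Σ_{j∈S} j⁻¹ ξ_j` (here `j ∈ S` is represented by the index `j : Fin r`, corresponding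
to the paper's index `j + 1`). -/
theorem mixed_directional_identity {n : ℕ} (r : ℕ)
    (ξ : Fin r → EuclideanSpace ℝ (Fin n))
    (f : EuclideanSpace ℝ (Fin n) → ℝ) (hf : ContDiff ℝ (r : ℕ∞) f)
    (x : EuclideanSpace ℝ (Fin n)) :
    ((List.ofFn fun j : Fin r => dirDeriv (ξ j)).foldr (· ∘ ·) id) f x
      = ∑ S : Finset (Fin r), (-1 : ℝ) ^ S.card *
          (dirDeriv (-∑ j ∈ S, (((j : ℕ) : ℝ) + 1)⁻¹ • ξ j))^[r] f x := by
  rw [foldr_ofFn_dirDeriv_apply r ξ f hf]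
  simp only [dirDeriv_iterate_apply r _ f hf]
  have h := MultilinearMap.sum_neg_one_pow_card_mul_map_neg_sum
    (iteratedFDeriv ℝ r f x).toMultilinearMap (hf.iteratedFDeriv_comp_perm x)
    (fun j => (((j : ℕ) : ℝ) + 1)⁻¹ • ξ j)
  have hfact : ∏ j : Fin r, (((j : ℕ) : ℝ) + 1) = r.factorial := by
    rw [Fin.prod_univ_eq_prod_range (fun j => (j : ℝ) + 1) r, ← Finset.prod_range_add_one_eq_factorial]
    push_cast
    rfl
  rw [MultilinearMap.map_smul_univ, Finset.prod_inv_distrib, hfact, Fintype.card_fin, smul_eq_mul,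
    mul_inv_cancel_left₀ (by positivity)] at h
  exact h.symm
end
end
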